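/- Assume Conditions (C). There exists a constant A > 0 such that if the quadruple of sequences (m, l, h, y) verifies Conditions (C3), then P( sup_{l ≤ i ≤ j ≤ m} | L̃^h_j − L̃^h_i − E[L̃^h_j − L̃^h_i] | ≥ y ) ≤ A·exp(−y²/(A(y·n^{1/3} + m − l))). -/

import Mathlib

open MeasureTheory Filter Asymptotics
open scoped Classical ENNReal Topology

noncomputable section

/-- `ℓ_n`: the total weight. -/
def ell (w : ∀ n : ℕ, Fin n → ℝ) (n : ℕ) : ℝ := ∑ i, w n i

/-- Conditions (C) on the triangular array of weights, relative to the law `μ` of the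
limiting random variable `W`. -/
structure CondC (w : ∀ n : ℕ, Fin n → ℝ) (μ : Measure ℝ) : Prop where
  isProb : IsProbabilityMeasure μ
  pos : ∀ᵐ x ∂μ, 0 < x
  w_pos : ∀ n, ∀ i : Fin n, 0 < w n i
  w_anti : ∀ n, ∀ i j : Fin n, i ≤ j → w n j ≤ w n i
  int3 : Integrable (fun x => x ^ 3) μ
  moment_eq : ∫ x, x ^ 2 ∂μ = ∫ x, x ∂μ
  weak : ∀ g : BoundedContinuousFunction ℝ ℝ,
    Tendsto (fun n : ℕ => (∑ i : Fin n, g (w n i)) / (n : ℝ)) atTop (𝓝 (∫ x, g x ∂μ))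
  ell_asymp : (fun n : ℕ => ell w n - (∫ x, x ∂μ) * (n : ℝ)) =o[atTop]
      fun n : ℕ => (n : ℝ) ^ ((2 : ℝ) / 3)
  sq_asymp : (fun n : ℕ => (∑ i : Fin n, (w n i) ^ 2) - (∫ x, x ^ 2 ∂μ) * (n : ℝ)) =o[atTop]
      fun n : ℕ => (n : ℝ) ^ ((2 : ℝ) / 3)
  cube_asymp : (fun n : ℕ => (∑ i : Fin n, (w n i) ^ 3) - (∫ x, x ^ 3 ∂μ) * (n : ℝ)) =o[atTop]
      fun _ : ℕ => (1 : ℝ)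
  max_asymp : (fun n : ℕ => ⨆ i : Fin n, w n i) =o[atTop] fun n : ℕ => (n : ℝ) ^ ((1 : ℝ) / 3)

/-- The constant `C = E[W³]/E[W]`. -/
def Cconst (μ : Measure ℝ) : ℝ := (∫ x, x ^ 3 ∂μ) / (∫ x, x ∂μ)

/-- The critical percolation parameter `p_f = (ℓ_n^{1/3} + f_n)/ℓ_n^{4/3}`. -/
def pf (w : ∀ n : ℕ, Fin n → ℝ) (f : ℕ → ℝ) (n : ℕ) : ℝ :=
  (ell w n ^ ((1 : ℝ) / 3) + f n) / ell w n ^ ((4 : ℝ) / 3)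

/-- A Bernoulli-type measure on `Bool` with parameter `p`. -/
def bern (p : ℝ) : Measure Bool :=
  ENNReal.ofReal (1 - p) • Measure.dirac false + ENNReal.ofReal p • Measure.dirac true

/-- The law of the independent edge indicators of the rank-1 inhomogeneous random graph
`G(W,p)`: the indicator attached to the (ordered) pair `(i,j)` is Bernoulli with success
probability `1 - exp (- w i * w j * p)`, all independent. -/
def graphMeasure (n : ℕ) (wn : Fin n → ℝ) (p : ℝ) : Measure (Fin n → Fin n → Bool) :=
  Measure.pi fun i => Measure.pi fun j => bern (1 - Real.exp (-(wn i * wn j * p)))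

/-- The simple graph built from a sample of edge indicators: `i ~ j` iff `i ≠ j` and the
indicator of the pair `(min i j, max i j)` is `true`. -/
def graphOf {n : ℕ} (ω : Fin n → Fin n → Bool) : SimpleGraph (Fin n) :=
  SimpleGraph.fromRel fun i j => ω (min i j) (max i j) = true

/-- The size (number of vertices) of a connected component. -/
def csize {n : ℕ} (G : SimpleGraph (Fin n)) (c : G.ConnectedComponent) : ℕ :=
  Nat.card {v : Fin n // G.connectedComponentMk v = c}

/-- The weight of a connected component: sum of the weights of its vertices. -/
def cweight {n : ℕ} (wn : Fin n → ℝ) (G : SimpleGraph (Fin n)) (c : G.ConnectedComponent) : ℝ :=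
  ∑ v : Fin n, if G.connectedComponentMk v = c then wn v else 0

/-- The number of edges of a connected component. -/
def cedges {n : ℕ} (G : SimpleGraph (Fin n)) (c : G.ConnectedComponent) : ℕ :=
  Nat.card {e : Sym2 (Fin n) // e ∈ G.edgeSet ∧ ∀ v ∈ e, G.connectedComponentMk v = c}

/-- The surplus (excess) of a connected component: edges − vertices + 1. -/
def csurplus {n : ℕ} (G : SimpleGraph (Fin n)) (c : G.ConnectedComponent) : ℤ :=
  (cedges G c : ℤ) - (csize G c : ℤ) + 1

/-- `c` is a largest connected component. -/
def isLargest {n : ℕ} (G : SimpleGraph (Fin n)) (c : G.ConnectedComponent) : Prop :=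
  ∀ c', csize G c' ≤ csize G c

/-- The finset of connected components of a graph on `Fin n`. -/
def comps {n : ℕ} (G : SimpleGraph (Fin n)) : Finset G.ConnectedComponent :=
  Finset.univ.image G.connectedComponentMk

/-- The law of the size-biased random order without replacement `(v(1),…,v(n))`, seen as a
measure on functions `Fin n → Fin n` (supported on permutations `σ`, with
`P(v = σ) = ∏_i w (σ i) / (ℓ_n − ∑_{k<i} w (σ k))`). -/
def sbMeasure (n : ℕ) (wn : Fin n → ℝ) : Measure (Fin n → Fin n) :=
  Measure.sum fun σ : Equiv.Perm (Fin n) =>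
    ENNReal.ofReal (∏ i : Fin n,
        wn (σ i) / ((∑ k, wn k) - ∑ k ∈ Finset.univ.filter fun k => k < i, wn (σ k))) •
      Measure.dirac ⇑σ

/-- The joint law of (edge indicators of `G(W,p)`, size-biased order), the two being
independent. -/
def expMeasure' (n : ℕ) (wn : Fin n → ℝ) (p : ℝ) :
    Measure ((Fin n → Fin n → Bool) × (Fin n → Fin n)) :=
  Measure.sum fun σ : Equiv.Perm (Fin n) =>
    ENNReal.ofReal (∏ i : Fin n,
        wn (σ i) / ((∑ k, wn k) - ∑ k ∈ Finset.univ.filter fun k => k < i, wn (σ k))) •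
      (graphMeasure n wn p).map fun g => (g, ⇑σ)

/-- `sbW wn vord k` is `w_{v(k)}` (1-based), with the conventions `w_{v(0)} = 0` and
`w_{v(k)} = 0` for `k > n`. -/
def sbW {n : ℕ} (wn : Fin n → ℝ) (vord : Fin n → Fin n) (k : ℕ) : ℝ :=
  if h : k - 1 < n then (if k = 0 then 0 else wn (vord ⟨k - 1, h⟩)) else 0

/-- The (0-based) first position, in the order `vord`, of a vertex of the component `c`;
this governs the order in which components are discovered by the breadth-first walk. -/
def firstIdx {n : ℕ} (G : SimpleGraph (Fin n)) (vord : Fin n → Fin n)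
    (c : G.ConnectedComponent) : ℕ :=
  sInf {i : ℕ | ∃ h : i < n, G.connectedComponentMk (vord ⟨i, h⟩) = c}

/-- The number of vertices explored strictly before the exploration of the component `c`
starts: components are explored in the order of their first appearance in `vord`, and the
exploration of `c` occupies the steps `startT c + 1, …, startT c + csize c`. -/
def startT {n : ℕ} (G : SimpleGraph (Fin n)) (vord : Fin n → Fin n)
    (c : G.ConnectedComponent) : ℕ :=
  ∑ v : Fin n, if firstIdx G vord (G.connectedComponentMk v) < firstIdx G vord c then 1 else 0

/-- The state (explored vertices, queue of discovered-but-unexplored vertices) of the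
breadth-first walk after `i` steps; roots are chosen as the first undiscovered vertex in the
order `vord`, and children are queued in the order `vord`. -/
def bfwQueue {n : ℕ} (G : SimpleGraph (Fin n)) (vord : Fin n → Fin n) :
    ℕ → Finset (Fin n) × List (Fin n)
  | 0 => (∅, [])
  | i + 1 =>
    let s := bfwQueue G vord i
    let q : List (Fin n) :=
      if s.2.isEmpty then ((List.ofFn vord).filter fun v => decide (v ∉ s.1)).take 1 else s.2
    match q with
    | [] => (s.1, [])
    | v :: rest =>
      (insert v s.1,
        rest ++ (List.ofFn vord).filter fun u => decide (G.Adj v u ∧ u ∉ s.1 ∧ u ∉ q))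

/-- The reflected exploration process `L` of the breadth-first walk:
`L_0 = 1`, `L_{i+1} = max (L_i + c(i+1) - 1) 1`. -/
def Lproc {n : ℕ} (G : SimpleGraph (Fin n)) (vord : Fin n → Fin n) (i : ℕ) : ℕ :=
  max (bfwQueue G vord i).2.length 1

/-- `discNbrs G vord i` is the number of neighbours of `v(i+1)` (0-based: `vord i`) outside
`{v(1),…,v(i+1)}`, i.e. the increment `X⁰_{i+1} + 1` of the process `L⁰`. -/
def discNbrs {n : ℕ} (G : SimpleGraph (Fin n)) (vord : Fin n → Fin n) (i : ℕ) : ℕ :=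
  Nat.card {j : Fin n // (∃ h : i < n, G.Adj (vord ⟨i, h⟩) j) ∧
    ∀ k : ℕ, ∀ hk : k < n, k ≤ i → vord ⟨k, hk⟩ ≠ j}

/-- The process `L⁰`: `L⁰_0 = 1`, `L⁰_{i+1} = L⁰_i + X⁰_{i+1}` where
`X⁰_{i+1} = ∑_{j ∉ {v(1),…,v(i+1)}} Y(v(i+1), j) − 1`. -/
def L0 {n : ℕ} (G : SimpleGraph (Fin n)) (vord : Fin n → Fin n) (m : ℕ) : ℤ :=
  1 - (m : ℤ) + ∑ i ∈ Finset.range m, (discNbrs G vord i : ℤ)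

/-- The deterministic-drift process `L̃^h`, defined by
`L̃^h_m + m − 1 = ∑_{i=1}^m ∑_{k > i+h} (1 − exp (−w_{v(i)} w_{v(k)} p))`,
the inner sum being over positions `k ≤ n` in the size-biased order. -/
def Ltilde {n : ℕ} (wn : Fin n → ℝ) (p : ℝ) (vord : Fin n → Fin n) (h m : ℕ) : ℝ :=
  1 - (m : ℝ) + ∑ i ∈ Finset.range m,
    if hi : i < n then
      ∑ k : Fin n, if i + h < (k : ℕ) then
        1 - Real.exp (-(wn (vord ⟨i, hi⟩) * wn (vord k) * p)) else 0
    else 0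

/-- The law of the independent exponential clocks `(T_k)_{k ≤ n}`, `T_k` of rate `w_k / ℓ_n`. -/
def clocksMeasure (n : ℕ) (wn : Fin n → ℝ) : Measure (Fin n → ℝ) :=
  Measure.pi fun k => ProbabilityTheory.expMeasure (wn k / ∑ i, wn i)

/-- `N(x)`: the number of clocks that have rung by time `x`. -/
def Nclock {n : ℕ} (x : ℝ) (ω : Fin n → ℝ) : ℕ :=
  ∑ k : Fin n, if ω k ≤ x then 1 else 0

/-- `X(x)`: the total weight of the clocks that have rung by time `x`. -/
def Xclock {n : ℕ} (wn : Fin n → ℝ) (x : ℝ) (ω : Fin n → ℝ) : ℝ :=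
  ∑ k : Fin n, if ω k ≤ x then wn k else 0

/-- Conditions (C2) on a pair of sequences `(a, b)`, relative to the constant `Ā`. -/
structure Cond2 (w : ∀ n : ℕ, Fin n → ℝ) (Abar : ℝ) (a b : ℕ → ℝ) : Prop where
  exp_lt : ∀ᶠ n : ℕ in atTop,
    Real.exp (-(b n) ^ 2 / (Abar * (b n * (n : ℝ) ^ ((1 : ℝ) / 3) + a n))) < 1 / 4
  a_top : Tendsto a atTop atTop
  b_top : Tendsto b atTop atTop
  a_lito : a =o[atTop] fun n : ℕ => (n : ℝ)
  b_bigO : b =O[atTop] a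
  a_bigO : a =O[atTop] fun n => b n * ell w n ^ ((1 : ℝ) / 3)
  a_sq_bigO : (fun n => a n ^ 2) =O[atTop] fun n => b n * ell w n

/-- Conditions (C3) on a quadruple of sequences `(a, b, c, d)`. -/
structure Cond3 (w : ∀ n : ℕ, Fin n → ℝ) (Abar : ℝ) (a b c d : ℕ → ℝ) : Prop where
  sum_lito : (fun n => a n + c n) =o[atTop] fun n : ℕ => (n : ℝ)
  diff_top : Tendsto (fun n => a n - b n) atTop atTop
  d_bigO : d =O[atTop] fun n => a n - b n
  c2 : Cond2 w Abar (fun n => Real.sqrt ((a n - b n) * (a n + c n))) d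

/-- The list of component sizes, sorted in decreasing order. -/
def sizesList {n : ℕ} (G : SimpleGraph (Fin n)) : List ℕ :=
  (((comps G).val.map fun c => csize G c).sort (· ≤ ·)).reverse

/-- `kthSize G k` is the size of the `(k+1)`-st largest connected component of `G`
(`0` if there is no such component). -/
def kthSize {n : ℕ} (G : SimpleGraph (Fin n)) (k : ℕ) : ℕ := (sizesList G).getD k 0

end


namespace DPC
open Finset

noncomputable section

/-- value of `g` at the `r`-th (0-based) vertex of the order `σ` -/
def xs {n : ℕ} (g : Fin n → ℝ) (σ : Fin n → Fin n) (r : ℕ) : ℝ :=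
  if h : r < n then g (σ ⟨r, h⟩) else 0

/-- conditional expectation of `g (σ r)` given the first `r` vertices -/
def cnd {n : ℕ} (w g : Fin n → ℝ) (σ : Fin n → Fin n) (r : ℕ) : ℝ :=
  ((∑ k, w k * g k) - ∑ i ∈ Finset.range r, xs (fun k => w k * g k) σ i) /
    ((∑ k, w k) - ∑ i ∈ Finset.range r, xs w σ i)

/-- the probability of the permutation `σ` -/
def PP {n : ℕ} (w : Fin n → ℝ) (σ : Equiv.Perm (Fin n)) : ℝ :=
  ∏ i : Fin n, w (σ i) / ((∑ k, w k) - ∑ k ∈ Finset.univ.filter fun k => k < i, w (σ k))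

/-- expectation -/
def EE {n : ℕ} (w : Fin n → ℝ) (F : (Fin n → Fin n) → ℝ) : ℝ :=
  ∑ σ : Equiv.Perm (Fin n), PP w σ * F ⇑σ

/-- partial product -/
def TT {n : ℕ} (w : Fin n → ℝ) (r : ℕ) (σ : Fin n → Fin n) : ℝ :=
  ∏ i ∈ Finset.range r, xs w σ i / ((∑ k, w k) - ∑ k ∈ Finset.range i, xs w σ k)

/-- depends only on the first `r` entries -/
def Dep {n : ℕ} (r : ℕ) (u : (Fin n → Fin n) → ℝ) : Prop :=
  ∀ σ τ : Fin n → Fin n, (∀ i : Fin n, (i : ℕ) < r → σ i = τ i) → u σ = u τ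

lemma xs_lt {n : ℕ} (g : Fin n → ℝ) (σ : Fin n → Fin n) (i : Fin n) : xs g σ i = g (σ i) := by
  simp [xs]

lemma Dep_xs {n : ℕ} (g : Fin n → ℝ) {i r : ℕ} (h : i < r) : Dep r (fun σ => xs g σ i) := by
  intro σ τ hst
  simp only [xs]
  split_ifs with hi
  · rw [hst ⟨i, hi⟩ h]
  · rfl

lemma xs_c {n : ℕ} (g : Fin n → ℝ) {i r : ℕ} (h : i < r) {σ τ : Fin n → Fin n}
    (hst : ∀ i : Fin n, (i : ℕ) < r → σ i = τ i) : xs g σ i = xs g τ i := Dep_xs g h σ τ hst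

lemma Dep.mono {n : ℕ} {r s : ℕ} {u : (Fin n → Fin n) → ℝ} (h : Dep r u) (hrs : r ≤ s) :
    Dep s u := fun σ τ hst => h σ τ fun i hi => hst i (by omega)

lemma sum_xs_congr {n : ℕ} (g : Fin n → ℝ) {r : ℕ} {σ τ : Fin n → Fin n}
    (hst : ∀ i : Fin n, (i : ℕ) < r → σ i = τ i) :
    ∑ i ∈ Finset.range r, xs g σ i = ∑ i ∈ Finset.range r, xs g τ i :=
  Finset.sum_congr rfl fun i hi => Dep_xs g (Finset.mem_range.1 hi) σ τ hst

lemma Dep_cnd {n : ℕ} (w g : Fin n → ℝ) (r : ℕ) : Dep r (fun σ => cnd w g σ r) := by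
  intro σ τ hst
  simp only [cnd]
  rw [sum_xs_congr _ hst, sum_xs_congr _ hst]

lemma cnd_c {n : ℕ} (w g : Fin n → ℝ) {i r : ℕ} (h : i ≤ r) {σ τ : Fin n → Fin n}
    (hst : ∀ i : Fin n, (i : ℕ) < r → σ i = τ i) : cnd w g σ i = cnd w g τ i :=
  (Dep_cnd w g i).mono h σ τ hst

lemma Dep_TT {n : ℕ} (w : Fin n → ℝ) (r : ℕ) : Dep r (fun σ => TT w r σ) := by
  intro σ τ hst
  simp only [TT]
  refine Finset.prod_congr rfl fun i hi => ?_
  have hi := Finset.mem_range.1 hi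
  rw [xs_c w hi hst, sum_xs_congr w (fun j hj => hst j (hj.trans hi))]

lemma TT_c {n : ℕ} (w : Fin n → ℝ) {r : ℕ} {σ τ : Fin n → Fin n}
    (hst : ∀ i : Fin n, (i : ℕ) < r → σ i = τ i) : TT w r σ = TT w r τ := Dep_TT w r σ τ hst

lemma sum_range_xs {n : ℕ} (g : Fin n → ℝ) (σ : Fin n → Fin n) (i : ℕ) (hi : i ≤ n) :
    ∑ k ∈ Finset.range i, xs g σ k = 
      ∑ k ∈ Finset.univ.filter (fun k : Fin n => (k : ℕ) < i), g (σ k) := by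
  rw [Finset.sum_filter]
  have : ∀ k : Fin n, (if (k : ℕ) < i then g (σ k) else 0) =
      (fun k : ℕ => if k < i then xs g σ k else 0) k := by
    intro k; simp [xs_lt]
  simp_rw [this]
  rw [Fin.sum_univ_eq_sum_range (fun k : ℕ => if k < i then xs g σ k else 0) n,
    ← Finset.sum_filter]
  refine Finset.sum_congr ?_ fun _ _ => rfl
  ext k; simp; omega

lemma PP_eq {n : ℕ} (w : Fin n → ℝ) (σ : Equiv.Perm (Fin n)) : PP w σ = TT w n σ := by
  rw [PP, TT, ← Fin.prod_univ_eq_prod_range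
    (fun i => xs w σ i / ((∑ k, w k) - ∑ k ∈ Finset.range i, xs w σ k)) n]
  refine Finset.prod_congr rfl fun i _ => ?_
  rw [xs_lt, sum_range_xs w σ i i.2.le]
  rfl

lemma total_sub {n : ℕ} (g : Fin n → ℝ) (σ : Equiv.Perm (Fin n)) (r : ℕ) (hr : r ≤ n) :
    (∑ k, g k) - ∑ i ∈ Finset.range r, xs g σ i =
      ∑ k ∈ Finset.univ.filter (fun k : Fin n => r ≤ (k : ℕ)), g (σ k) := by
  rw [sum_range_xs g σ r hr, ← Equiv.sum_comp σ g,
    ← Finset.sum_filter_add_sum_filter_not Finset.univ (fun k : Fin n => (k : ℕ) < r)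
      (fun k => g (σ k))]
  simp

lemma rem_pos {n : ℕ} {w : Fin n → ℝ} (hw : ∀ i, 0 < w i) (σ : Equiv.Perm (Fin n)) (r : ℕ)
    (hr : r < n) : 0 < (∑ k, w k) - ∑ i ∈ Finset.range r, xs w σ i := by
  rw [total_sub w σ r hr.le]
  exact Finset.sum_pos (fun i _ => hw _) ⟨⟨r, hr⟩, by simp⟩

lemma PP_nonneg {n : ℕ} {w : Fin n → ℝ} (hw : ∀ i, 0 < w i) (σ : Equiv.Perm (Fin n)) :
    0 ≤ PP w σ := by
  rw [PP_eq]
  refine Finset.prod_nonneg fun i hi => ?_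
  have hi := Finset.mem_range.1 hi
  have h1 := rem_pos hw σ i hi
  have : 0 ≤ xs w σ i := by simp only [xs, hi, dif_pos]; exact (hw _).le
  positivity

lemma swap_avg {n : ℕ} (r : ℕ) (hr : r < n) (u : (Fin n → Fin n) → ℝ) (hu : Dep r u)
    (g : Fin n → ℝ) :
    ((n : ℝ) - r) * ∑ σ : Equiv.Perm (Fin n), u σ * xs g σ r =
      ∑ σ : Equiv.Perm (Fin n), u σ *
        ∑ k ∈ Finset.univ.filter (fun k : Fin n => r ≤ (k : ℕ)), g (σ k) := by
  have key : ∀ k : Fin n, r ≤ (k : ℕ) →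
      ∑ σ : Equiv.Perm (Fin n), u σ * g (σ k) = ∑ σ : Equiv.Perm (Fin n), u σ * xs g σ r := by
    intro k hk
    refine Fintype.sum_equiv (Equiv.mulRight (Equiv.swap ⟨r, hr⟩ k)) _ _ fun σ => ?_
    have e1 : u ⇑(σ * Equiv.swap ⟨r, hr⟩ k) = u σ := by
      refine hu _ _ fun i hi => ?_
      rw [Equiv.Perm.mul_apply, Equiv.swap_apply_of_ne_of_ne]
      · intro h; rw [h] at hi; simp at hi
      · intro h; rw [h] at hi; omega
    simp only [Equiv.coe_mulRight, e1]
    congr 1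
    simp [xs, hr]
  simp_rw [Finset.mul_sum]
  rw [Finset.sum_comm, Finset.sum_congr rfl (fun k hk => key k (Finset.mem_filter.1 hk).2)]
  rw [Finset.sum_const, ← Finset.mul_sum, nsmul_eq_mul]
  congr 1
  have : (Finset.univ.filter (fun k : Fin n => r ≤ (k : ℕ))) = Finset.Ici (⟨r, hr⟩ : Fin n) := by
    ext k; simp [Fin.le_def]
  rw [this, Fin.card_Ici]
  push_cast [hr.le]; simp

lemma step_sum {n : ℕ} {w : Fin n → ℝ} (r : ℕ) (hr : r < n)
    (u : (Fin n → Fin n) → ℝ) (hu : Dep r u) (g : Fin n → ℝ) :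
    ((n : ℝ) - r) * ∑ σ : Equiv.Perm (Fin n), TT w (r + 1) σ * (u σ * xs g σ r) =
      ∑ σ : Equiv.Perm (Fin n), TT w r σ * (u σ * cnd w g σ r) := by
  have := swap_avg r hr (fun σ => TT w r σ * u σ / ((∑ k, w k) - ∑ k ∈ Finset.range r, xs w σ k))
    (by
      intro σ τ hst
      simp only
      rw [TT_c w hst, hu σ τ hst, sum_xs_congr w hst]) (fun k => w k * g k)
  convert this using 1
  · congr 1
    refine Finset.sum_congr rfl fun σ _ => ?_
    rw [TT, Finset.prod_range_succ, ← TT]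
    simp only [xs, hr, dif_pos]
    ring
  · refine Finset.sum_congr rfl fun σ _ => ?_
    rw [cnd, ← total_sub (fun k => w k * g k) σ r hr.le]
    ring

lemma cnd_one {n : ℕ} {w : Fin n → ℝ} (hw : ∀ i, 0 < w i) (σ : Equiv.Perm (Fin n)) (r : ℕ)
    (hr : r < n) : cnd w (fun _ => 1) σ r = 1 := by
  simp only [cnd, mul_one]
  exact div_self (rem_pos hw σ r hr).ne'

lemma marg {n : ℕ} {w : Fin n → ℝ} (hw : ∀ i, 0 < w i) (d : ℕ) : ∀ (r : ℕ), r + d = n →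
    ∀ (u : (Fin n → Fin n) → ℝ), Dep r u →
    EE w u = (∑ σ : Equiv.Perm (Fin n), TT w r σ * u σ) / (d.factorial : ℝ) := by
  induction d with
  | zero =>
    intro r hr u hu
    have : r = n := by omega
    subst this
    simp [EE, PP_eq]
  | succ d ih =>
    intro r hr u hu
    have hrn : r < n := by omega
    rw [ih (r + 1) (by omega) u (hu.mono (by omega))]
    have := step_sum (w := w) r hrn u hu (fun _ => 1)
    have e1 : ∀ σ : Fin n → Fin n, xs (fun _ => (1 : ℝ)) σ r = 1 := by intro σ; simp [xs, hrn]
    simp only [e1, mul_one] at this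
    have e3 : ∑ σ : Equiv.Perm (Fin n), TT w r σ * (u σ * cnd w (fun _ => 1) σ r) =
        ∑ σ : Equiv.Perm (Fin n), TT w r σ * u σ :=
      Finset.sum_congr rfl (fun σ _ => by rw [cnd_one hw σ r hrn, mul_one])
    rw [e3] at this
    rw [← this, Nat.factorial_succ]
    have e2 : (n : ℝ) - r = d + 1 := by rw [← hr]; push_cast; ring
    rw [e2]
    have : (d.factorial : ℝ) ≠ 0 := by positivity
    push_cast
    field_simp

lemma EE_one {n : ℕ} {w : Fin n → ℝ} (hw : ∀ i, 0 < w i) (c : ℝ) : EE w (fun _ => c) = c := by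
  rw [marg hw n 0 (by omega) _ (fun _ _ _ => rfl)]
  simp [TT, Finset.card_univ, Fintype.card_perm]
  field_simp

lemma tower {n : ℕ} {w : Fin n → ℝ} (hw : ∀ i, 0 < w i) (r : ℕ) (hr : r < n)
    (u : (Fin n → Fin n) → ℝ) (hu : Dep r u) (g : Fin n → ℝ) :
    EE w (fun σ => u σ * xs g σ r) = EE w (fun σ => u σ * cnd w g σ r) := by
  obtain ⟨d, rfl⟩ : ∃ d, n = r + 1 + d := ⟨n - r - 1, by omega⟩
  rw [marg hw d (r + 1) (by omega) (fun σ => u σ * xs g σ r) (by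
      intro σ τ hst
      simp only
      rw [hu.mono (Nat.le_succ r) σ τ hst, xs_c g (Nat.lt_succ_self r) hst]),
    marg hw (d + 1) r (by omega) (fun σ => u σ * cnd w g σ r) (by
      intro σ τ hst
      simp only
      rw [hu σ τ hst, cnd_c w g le_rfl hst]), ← step_sum r hr u hu g, Nat.factorial_succ]
  have : (d.factorial : ℝ) ≠ 0 := by positivity
  have h2 : (((r + 1 + d : ℕ) : ℝ) - r) = (d : ℝ) + 1 := by push_cast; ring
  have h3 : (d : ℝ) + 1 ≠ 0 := by positivity
  rw [h2]
  push_cast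
  field_simp

lemma EE_mono {n : ℕ} {w : Fin n → ℝ} (hw : ∀ i, 0 < w i) {F G : (Fin n → Fin n) → ℝ}
    (h : ∀ σ : Equiv.Perm (Fin n), F σ ≤ G σ) : EE w F ≤ EE w G :=
  Finset.sum_le_sum fun σ _ => mul_le_mul_of_nonneg_left (h σ) (PP_nonneg hw σ)

lemma EE_add {n : ℕ} (w : Fin n → ℝ) (F G : (Fin n → Fin n) → ℝ) :
    EE w (fun σ => F σ + G σ) = EE w F + EE w G := by
  simp [EE, mul_add, Finset.sum_add_distrib]

lemma EE_smul {n : ℕ} (w : Fin n → ℝ) (c : ℝ) (F : (Fin n → Fin n) → ℝ) :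
    EE w (fun σ => c * F σ) = c * EE w F := by
  simp only [EE, Finset.mul_sum]
  exact Finset.sum_congr rfl fun σ _ => by ring

lemma EE_sum {n : ℕ} (w : Fin n → ℝ) {ι : Type*} (s : Finset ι) (F : ι → (Fin n → Fin n) → ℝ) :
    EE w (fun σ => ∑ k ∈ s, F k σ) = ∑ k ∈ s, EE w (F k) := by
  simp only [EE, Finset.mul_sum]
  exact Finset.sum_comm

/-- indicator -/
def ind (A : Prop) : ℝ := if A then 1 else 0

/-- martingale part -/
def SS {n : ℕ} (w g : Fin n → ℝ) (a s : ℕ) (σ : Fin n → Fin n) : ℝ :=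
  ∑ r ∈ Finset.Ico a s, (xs g σ r - cnd w g σ r)

lemma cnd_mono {n : ℕ} {w : Fin n → ℝ} (hw : ∀ i, 0 < w i) {g g' : Fin n → ℝ}
    (h : ∀ k, g k ≤ g' k) (σ : Equiv.Perm (Fin n)) (r : ℕ) (hr : r < n) :
    cnd w g σ r ≤ cnd w g' σ r := by
  simp only [cnd]
  refine div_le_div_of_nonneg_right ?_ (rem_pos hw σ r hr).le
  rw [total_sub _ σ r hr.le, total_sub _ σ r hr.le]
  exact Finset.sum_le_sum fun k _ => mul_le_mul_of_nonneg_left (h _) (hw _).le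

lemma xs_add {n : ℕ} (g g' : Fin n → ℝ) (σ : Fin n → Fin n) (r : ℕ) :
    xs (fun k => g k + g' k) σ r = xs g σ r + xs g' σ r := by
  simp only [xs]; split_ifs <;> simp

lemma xs_smul {n : ℕ} (c : ℝ) (g : Fin n → ℝ) (σ : Fin n → Fin n) (r : ℕ) :
    xs (fun k => c * g k) σ r = c * xs g σ r := by
  simp only [xs]; split_ifs <;> simp

lemma cnd_add {n : ℕ} (w g g' : Fin n → ℝ) (σ : Fin n → Fin n) (r : ℕ) :
    cnd w (fun k => g k + g' k) σ r = cnd w g σ r + cnd w g' σ r := by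
  simp only [cnd, mul_add, xs_add, Finset.sum_add_distrib]
  ring

lemma cnd_smul {n : ℕ} (w : Fin n → ℝ) (c : ℝ) (g : Fin n → ℝ) (σ : Fin n → Fin n) (r : ℕ) :
    cnd w (fun k => c * g k) σ r = c * cnd w g σ r := by
  have : ∀ k, w k * (c * g k) = c * (w k * g k) := fun k => by ring
  simp only [cnd, this, xs_smul, ← Finset.mul_sum]
  ring

lemma cnd_exp_le {n : ℕ} {w : Fin n → ℝ} (hw : ∀ i, 0 < w i) (g : Fin n → ℝ) (θ V : ℝ)
    (hθ : ∀ k, |θ * g k| ≤ 1) (σ : Equiv.Perm (Fin n)) (r : ℕ) (hr : r < n)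
    (hV : cnd w (fun k => g k ^ 2) σ r ≤ V) :
    cnd w (fun k => Real.exp (θ * g k)) σ r ≤ Real.exp (θ * cnd w g σ r + θ ^ 2 * V) := by
  have h1 : cnd w (fun k => Real.exp (θ * g k)) σ r ≤
      cnd w (fun k => (1 + θ * g k) + θ ^ 2 * g k ^ 2) σ r := by
    refine cnd_mono hw (fun k => ?_) σ r hr
    have := Real.abs_exp_sub_one_sub_id_le (hθ k)
    have := (abs_le.1 this).2
    nlinarith
  rw [cnd_add, cnd_add, cnd_one hw σ r hr, cnd_smul, cnd_smul w (θ ^ 2) (fun k => g k ^ 2)] at h1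
  have h2 := Real.add_one_le_exp (θ * cnd w g σ r + θ ^ 2 * V)
  have h3 := mul_le_mul_of_nonneg_left hV (sq_nonneg θ)
  linarith

lemma Dep_SS {n : ℕ} (w g : Fin n → ℝ) (a s : ℕ) : Dep s (fun σ => SS w g a s σ) := by
  intro σ τ hst
  simp only [SS]
  refine Finset.sum_congr rfl fun r hr => ?_
  have hr := (Finset.mem_Ico.1 hr).2
  rw [xs_c g hr hst, cnd_c w g hr.le hst]

lemma SS_c {n : ℕ} (w g : Fin n → ℝ) (a : ℕ) {s : ℕ} {σ τ : Fin n → Fin n}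
    (hst : ∀ i : Fin n, (i : ℕ) < s → σ i = τ i) : SS w g a s σ = SS w g a s τ :=
  Dep_SS w g a s σ τ hst

lemma maximal {n : ℕ} {w : Fin n → ℝ} (hw : ∀ i, 0 < w i) (g : Fin n → ℝ) (θ V t : ℝ)
    (a b : ℕ) (hab : a ≤ b) (hb : b ≤ n) (hθ : ∀ k, |θ * g k| ≤ 1) (hV0 : 0 ≤ V)
    (hV : ∀ σ : Equiv.Perm (Fin n), ∀ r, r < b → cnd w (fun k => g k ^ 2) σ r ≤ V) (ht : 0 < t) :
    EE w (fun σ => ind (∃ s, a ≤ s ∧ s ≤ b ∧ t < θ * SS w g a s σ)) ≤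
      Real.exp (-t + θ ^ 2 * ((b : ℝ) - a) * V) := by
  set T : ℝ := t - θ ^ 2 * ((b : ℝ) - a) * V with hT
  let Y : ℕ → (Fin n → Fin n) → ℝ := fun s σ =>
    Real.exp (θ * SS w g a s σ - θ ^ 2 * ((s : ℝ) - a) * V)
  let A : ℕ → (Fin n → Fin n) → Prop := fun s σ => ∃ s', a < s' ∧ s' ≤ s ∧ Real.exp T ≤ Y s' σ
  let F : ℕ → (Fin n → Fin n) → ℝ := fun s σ => if A s σ then Real.exp T else Y s σ
  have hYdep : ∀ s, Dep s (Y s) := by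
    intro s σ τ hst
    simp only [Y]
    rw [SS_c w g a hst]
  have hAdep : ∀ s σ τ, (∀ i : Fin n, (i : ℕ) < s → σ i = τ i) → (A s σ ↔ A s τ) := by
    intro s σ τ hst
    simp only [A]
    constructor
    · rintro ⟨s', h1, h2, h3⟩
      exact ⟨s', h1, h2, by rw [← (hYdep s').mono h2 σ τ hst]; exact h3⟩
    · rintro ⟨s', h1, h2, h3⟩
      exact ⟨s', h1, h2, by rw [(hYdep s').mono h2 σ τ hst]; exact h3⟩
  have hstep : ∀ s, a ≤ s → s < b → EE w (F (s + 1)) ≤ EE w (F s) := by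
    intro s has hsb
    have hsn : s < n := lt_of_lt_of_le hsb hb
    let u : (Fin n → Fin n) → ℝ := fun σ =>
      if A s σ then 0 else Y s σ * Real.exp (-(θ * cnd w g σ s) - θ ^ 2 * V)
    let c : (Fin n → Fin n) → ℝ := fun σ => if A s σ then Real.exp T else 0
    have hu : Dep s u := by
      intro σ τ hst
      simp only [u, hAdep s σ τ hst]
      rw [hYdep s σ τ hst, cnd_c w g le_rfl hst]
    have hY : ∀ σ, Y (s + 1) σ = Y s σ * Real.exp (-(θ * cnd w g σ s) - θ ^ 2 * V) *
        xs (fun k => Real.exp (θ * g k)) σ s := by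
      intro σ
      have e : xs (fun k => Real.exp (θ * g k)) σ s = Real.exp (θ * xs g σ s) := by
        simp [xs, hsn]
      simp only [Y, e, ← Real.exp_add, SS, Finset.sum_Ico_succ_top has]
      congr 1
      push_cast
      ring
    calc EE w (F (s + 1)) ≤ EE w (fun σ => c σ + u σ * xs (fun k => Real.exp (θ * g k)) σ s) := by
          refine EE_mono hw fun σ => ?_
          simp only [F, c, u]
          by_cases h1 : A s σ
          · have h2 : A (s + 1) σ := by
              obtain ⟨s', q1, q2, q3⟩ := h1
              exact ⟨s', q1, by omega, q3⟩
            simp [h1, h2]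
          · rw [if_neg h1, if_neg h1, zero_add, ← hY]
            split_ifs with h2
            · obtain ⟨s', q1, q2, q3⟩ := h2
              have : s' = s + 1 := by
                by_contra hne
                exact h1 ⟨s', q1, by omega, q3⟩
              rw [← this]; exact q3
            · exact le_rfl
      _ = EE w c + EE w (fun σ => u σ * cnd w (fun k => Real.exp (θ * g k)) σ s) := by
          rw [EE_add, tower hw s hsn u hu]
      _ = EE w (fun σ => c σ + u σ * cnd w (fun k => Real.exp (θ * g k)) σ s) := by
          rw [← EE_add]
      _ ≤ EE w (F s) := by
          refine EE_mono hw fun σ => ?_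
          simp only [F, c, u]
          by_cases h1 : A s σ
          · simp [h1]
          · simp only [if_neg h1, zero_add]
            have := cnd_exp_le hw g θ V hθ σ s hsn (hV σ s hsb)
            calc _ ≤ Y s σ * Real.exp (-(θ * cnd w g σ s) - θ ^ 2 * V) *
                  Real.exp (θ * cnd w g σ s + θ ^ 2 * V) :=
                  mul_le_mul_of_nonneg_left this (by positivity)
              _ = Y s σ := by
                  rw [mul_assoc, ← Real.exp_add]
                  have : -(θ * cnd w g σ s) - θ ^ 2 * V + (θ * cnd w g σ s + θ ^ 2 * V) = 0 := by
                    ring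
                  rw [this, Real.exp_zero, mul_one]
  have hall : ∀ d, a + d ≤ b → EE w (F (a + d)) ≤ EE w (F a) := by
    intro d
    induction d with
    | zero => intro _; exact le_rfl
    | succ d ih =>
      intro hd
      exact (hstep (a + d) (by omega) (by omega)).trans (ih (by omega))
  have hFa : EE w (F a) = 1 := by
    have : F a = fun _ => (1 : ℝ) := by
      funext σ
      have : ¬ A a σ := by rintro ⟨s', h1, h2, _⟩; omega
      simp [F, this, Y, SS]
    rw [this, EE_one hw]
  have hfin := hall (b - a) (by omega)
  rw [Nat.add_sub_cancel' hab, hFa] at hfin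
  have hlow : Real.exp T * EE w (fun σ => ind (∃ s, a ≤ s ∧ s ≤ b ∧ t < θ * SS w g a s σ)) ≤
      EE w (F b) := by
    rw [← EE_smul]
    refine EE_mono hw fun σ => ?_
    simp only [ind]
    split_ifs with h
    · obtain ⟨s, h1, h2, h3⟩ := h
      have hA : A b σ := by
        refine ⟨s, ?_, h2, ?_⟩
        · rcases h1.eq_or_lt with h | h
          · subst h; simp [SS] at h3; linarith
          · exact h
        · simp only [Y]
          refine Real.exp_le_exp.2 ?_
          have : (s : ℝ) ≤ b := by exact_mod_cast h2
          have : θ ^ 2 * ((s : ℝ) - a) * V ≤ θ ^ 2 * ((b : ℝ) - a) * V := by gcongr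
          linarith
      simp [F, hA]
    · simp only [mul_zero, F]
      split_ifs <;> positivity
  have hexp : Real.exp (-t + θ ^ 2 * ((b : ℝ) - a) * V) = (Real.exp T)⁻¹ := by
    rw [← Real.exp_neg]; congr 1; rw [hT]; ring
  rw [hexp, ← one_div, le_div_iff₀ (Real.exp_pos _)]
  linarith [hlow, hfin]

lemma maximal_abs {n : ℕ} {w : Fin n → ℝ} (hw : ∀ i, 0 < w i) (g : Fin n → ℝ) (θ V t : ℝ)
    (a b : ℕ) (hab : a ≤ b) (hb : b ≤ n) (hθ0 : 0 < θ) (hg : ∀ k, |g k| * θ ≤ 1) (hV0 : 0 ≤ V)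
    (hV : ∀ σ : Equiv.Perm (Fin n), ∀ r, r < b → cnd w (fun k => g k ^ 2) σ r ≤ V) (ht : 0 < t) :
    EE w (fun σ => ind (∃ s, a ≤ s ∧ s ≤ b ∧ t < |SS w g a s σ|)) ≤
      2 * Real.exp (-(θ * t) + θ ^ 2 * ((b : ℝ) - a) * V) := by
  have h1 := maximal hw g θ V (θ * t) a b hab hb
    (fun k => by rw [abs_mul, abs_of_pos hθ0, mul_comm]; exact hg k) hV0 hV (by positivity)
  have h2 := maximal hw g (-θ) V (θ * t) a b hab hb
    (fun k => by rw [abs_mul, abs_neg, abs_of_pos hθ0, mul_comm]; exact hg k) hV0 hV (by positivity)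
  rw [neg_sq] at h2
  have h3 : EE w (fun σ => ind (∃ s, a ≤ s ∧ s ≤ b ∧ t < |SS w g a s σ|)) ≤
      EE w (fun σ => ind (∃ s, a ≤ s ∧ s ≤ b ∧ θ * t < θ * SS w g a s σ) +
        ind (∃ s, a ≤ s ∧ s ≤ b ∧ θ * t < -θ * SS w g a s σ)) := by
    refine EE_mono hw fun σ => ?_
    have hn : ∀ A, 0 ≤ ind A := fun A => by simp only [ind]; split_ifs <;> norm_num
    by_cases h : ∃ s, a ≤ s ∧ s ≤ b ∧ t < |SS w g a s σ|
    · obtain ⟨s, q1, q2, q3⟩ := h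
      rw [ind, if_pos ⟨s, q1, q2, q3⟩]
      rcases lt_abs.1 q3 with q | q
      · have e : ind (∃ s, a ≤ s ∧ s ≤ b ∧ θ * t < θ * SS w g a s σ) = 1 := by
          rw [ind, if_pos ⟨s, q1, q2, by nlinarith⟩]
        rw [e]; linarith [hn (∃ s, a ≤ s ∧ s ≤ b ∧ θ * t < -θ * SS w g a s σ)]
      · have e : ind (∃ s, a ≤ s ∧ s ≤ b ∧ θ * t < -θ * SS w g a s σ) = 1 := by
          rw [ind, if_pos ⟨s, q1, q2, by nlinarith⟩]
        rw [e]; linarith [hn (∃ s, a ≤ s ∧ s ≤ b ∧ θ * t < θ * SS w g a s σ)]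
    · rw [ind, if_neg h]
      exact add_nonneg (hn _) (hn _)
  rw [EE_add] at h3
  linarith

end

end DPC

namespace DPC
open Finset

/-- deterministic hypotheses valid on the good event -/
structure DH (C K δ ε k y nn ℓ σ2 σ2l σ2h σ3l σ4l : ℝ) (l m M : ℕ) (x xl d dh dC : ℕ → ℝ) :
    Prop where
  C1 : 1 ≤ C
  K1 : 1 ≤ K
  δ0 : 0 ≤ δ
  δ1 : δ ≤ 1
  δ2 : 2 * C ^ 3 * δ ≤ 1
  ε0 : 0 < ε
  ε1 : ε ≤ 1
  k1 : 1 ≤ k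
  y0 : 0 < y
  nn0 : 0 < nn
  lm : l < m
  mM : m ≤ M
  ℓlo : nn ≤ C * ℓ
  σ2h0 : 0 ≤ σ2h
  σ2l0 : 0 ≤ σ2l
  σ2e : σ2 = σ2l + σ2h
  σ2C : σ2 ≤ C * nn
  σ3l0 : 0 ≤ σ3l
  σ3lC : σ3l ≤ C * nn
  σ4l0 : 0 ≤ σ4l
  yN : y ≤ K * ((m : ℝ) - l)
  NM : ((m : ℝ) - l) * M ≤ K * y * nn
  Mn : (M : ℝ) ≤ δ * nn
  h2 : σ2h ≤ δ * M
  h4 : M * σ4l ≤ δ * nn ^ 2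
  x0 : ∀ r, 0 ≤ x r
  xl0 : ∀ r, 0 ≤ xl r
  R : ∀ r, r ≤ M → nn ≤ 2 * C * (ℓ - ∑ i ∈ range r, x i)
  d_eq : ∀ r, r < M → d r = (σ2l - ∑ i ∈ range r, xl i ^ 2) / (ℓ - ∑ i ∈ range r, x i) + dh r
  dh0 : ∀ r, r < M → 0 ≤ dh r
  dh1 : ∀ r, r < M → dh r ≤ σ2h / (ℓ - ∑ i ∈ range r, x i)
  dC1 : ∀ r, r < M → dC r ≤ σ4l / (ℓ - ∑ i ∈ range r, x i)
  hX : ∀ s, s ≤ M → |∑ r ∈ range s, (x r - d r)| ≤ k * ε * y * M / ((m : ℝ) - l)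
  hQ : ∀ s, s ≤ M → |∑ r ∈ range s, (xl r ^ 2 -
      (σ3l - ∑ i ∈ range r, xl i ^ 3) / (ℓ - ∑ i ∈ range r, x i))| ≤
      k * ε * (y * nn / ((m : ℝ) - l))
  hCc : ∀ s, s ≤ M → |∑ r ∈ range s, (xl r ^ 3 - dC r)| ≤
      k * ε * (y * nn / ((m : ℝ) - l)) * (nn / M)
  hW : ∀ s, l ≤ s → s ≤ m → |∑ r ∈ Ico l s, (x r - d r)| ≤ k * ε * y

lemma sum_close {f g : ℕ → ℝ} {c b e : ℝ} {s M : ℕ} (hs : s ≤ M) (hb : 0 ≤ b)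
    (h1 : |∑ r ∈ range s, (f r - g r)| ≤ e) (h2 : ∀ r, r < s → |g r - c| ≤ b) :
    |∑ r ∈ range s, f r - c * s| ≤ e + M * b := by
  have e1 : ∑ r ∈ range s, f r - c * s =
      ∑ r ∈ range s, (f r - g r) + ∑ r ∈ range s, (g r - c) := by
    simp [Finset.sum_sub_distrib]; ring
  have e2 : |∑ r ∈ range s, (g r - c)| ≤ s * b := by
    refine (Finset.abs_sum_le_sum_abs _ _).trans ?_
    refine (Finset.sum_le_card_nsmul _ _ b fun r hr => h2 r (mem_range.1 hr)).trans ?_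
    simp
  have e3 : (s : ℝ) * b ≤ M * b := by
    have : (s : ℝ) ≤ M := by exact_mod_cast hs
    gcongr
  rw [e1]
  refine (abs_add_le _ _).trans ?_
  linarith

lemma sum_upper {f g : ℕ → ℝ} {b e : ℝ} {s M : ℕ} (hs : s ≤ M) (hb : 0 ≤ b)
    (h1 : |∑ r ∈ range s, (f r - g r)| ≤ e) (h2 : ∀ r, r < s → g r ≤ b) :
    ∑ r ∈ range s, f r ≤ e + M * b := by
  have e1 : ∑ r ∈ range s, f r =
      ∑ r ∈ range s, (f r - g r) + ∑ r ∈ range s, g r := by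
    simp [Finset.sum_sub_distrib]
  have e2 : ∑ r ∈ range s, g r ≤ s * b := by
    refine (Finset.sum_le_card_nsmul _ _ b fun r hr => h2 r (mem_range.1 hr)).trans ?_
    simp
  have e3 : (s : ℝ) * b ≤ M * b := by
    have : (s : ℝ) ≤ M := by exact_mod_cast hs
    gcongr
  have := le_abs_self (∑ r ∈ range s, (f r - g r))
  rw [e1]; linarith

lemma div_bd {C nn R z Z : ℝ} (hnn : 0 < nn) (hC : 0 < C) (hR : nn ≤ 2 * C * R) (hz : z ≤ Z)
    (hZ : 0 ≤ Z) : z / R ≤ 2 * C / nn * Z := by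
  have hR0 : 0 < R := by
    by_contra h
    push Not at h
    nlinarith
  rw [div_le_iff₀ hR0]
  have : 2 * C / nn * Z * R = (2 * C * R) / nn * Z := by ring
  rw [this]
  have h1 : 1 ≤ (2 * C * R) / nn := by rw [le_div_iff₀ hnn]; linarith
  nlinarith

section
variable {C K δ ε k y nn ℓ σ2 σ2l σ2h σ3l σ4l : ℝ} {l m M : ℕ} {x xl d dh dC : ℕ → ℝ}

lemma DH.N0 (H : DH C K δ ε k y nn ℓ σ2 σ2l σ2h σ3l σ4l l m M x xl d dh dC) :
    0 < (m : ℝ) - l := by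
  have : (l : ℝ) < m := by exact_mod_cast H.lm
  linarith

lemma DH.M0 (H : DH C K δ ε k y nn ℓ σ2 σ2l σ2h σ3l σ4l l m M x xl d dh dC) :
    0 < (M : ℝ) := by
  have h1 : 0 < M := by have := H.lm; have := H.mM; omega
  exact_mod_cast h1

lemma DH.MT (H : DH C K δ ε k y nn ℓ σ2 σ2l σ2h σ3l σ4l l m M x xl d dh dC) :
    (M : ℝ) ≤ K * (y * nn / ((m : ℝ) - l)) := by
  have := H.NM
  rw [← mul_div_assoc, le_div_iff₀ H.N0]
  linarith

lemma DH.d_le (H : DH C K δ ε k y nn ℓ σ2 σ2l σ2h σ3l σ4l l m M x xl d dh dC) (r : ℕ)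
    (hr : r < M) : d r ≤ 2 * C ^ 2 := by
  have hC : 0 < C := by linarith [H.C1]
  have hnn := H.nn0
  have hQ0 : 0 ≤ ∑ i ∈ range r, xl i ^ 2 := Finset.sum_nonneg fun i _ => sq_nonneg _
  rw [H.d_eq r hr]
  have h1 : (σ2l - ∑ i ∈ range r, xl i ^ 2) / (ℓ - ∑ i ∈ range r, x i) ≤ 2 * C / nn * σ2l :=
    div_bd H.nn0 hC (H.R r hr.le) (by linarith) H.σ2l0
  have h2 : dh r ≤ 2 * C / nn * σ2h :=
    (H.dh1 r hr).trans (div_bd H.nn0 hC (H.R r hr.le) le_rfl H.σ2h0)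
  have h3 : 2 * C / nn * σ2l + 2 * C / nn * σ2h ≤ 2 * C / nn * (C * nn) := by
    rw [← mul_add, ← H.σ2e]
    have := H.σ2C
    gcongr
  have h4 : 2 * C / nn * (C * nn) = 2 * C ^ 2 := by field_simp
  linarith

lemma DH.X_le (H : DH C K δ ε k y nn ℓ σ2 σ2l σ2h σ3l σ4l l m M x xl d dh dC) (r : ℕ)
    (hr : r ≤ M) : ∑ i ∈ range r, x i ≤ k * M * (2 * C ^ 2 + K) := by
  have h1 := sum_upper hr (b := 2 * C ^ 2) (by positivity) (H.hX r hr)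
    (fun i hi => H.d_le i (by omega))
  have hN := H.N0
  have hM := H.M0
  have h2 : k * ε * y * M / ((m : ℝ) - l) ≤ k * M * K := by
    rw [div_le_iff₀ hN]
    have hk : 0 ≤ k := by linarith [H.k1]
    have hy := H.y0
    have hε := H.ε0
    calc k * ε * y * M ≤ k * 1 * (K * ((m : ℝ) - l)) * M := by
          have := H.ε1
          have := H.yN
          gcongr
      _ = _ := by ring
  have h3 : (M : ℝ) * (2 * C ^ 2) ≤ k * M * (2 * C ^ 2) := by
    have := H.k1
    have h : 0 ≤ (M : ℝ) * (2 * C ^ 2) := by positivity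
    nlinarith
  linarith

lemma DH.Q_le (H : DH C K δ ε k y nn ℓ σ2 σ2l σ2h σ3l σ4l l m M x xl d dh dC) (r : ℕ)
    (hr : r ≤ M) : ∑ i ∈ range r, xl i ^ 2 ≤
      k * ε * (y * nn / ((m : ℝ) - l)) + M * (2 * C ^ 2) := by
  have hC : 0 < C := by linarith [H.C1]
  have hnn := H.nn0
  refine sum_upper hr (by positivity) (H.hQ r hr) fun i hi => ?_
  have hQ0 : 0 ≤ ∑ j ∈ range i, xl j ^ 3 := Finset.sum_nonneg fun j _ => pow_nonneg (H.xl0 j) 3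
  have h1 : (σ3l - ∑ j ∈ range i, xl j ^ 3) / (ℓ - ∑ j ∈ range i, x j) ≤ 2 * C / nn * (C * nn) :=
    div_bd H.nn0 hC (H.R i (by omega)) (by linarith [H.σ3lC]) (by positivity)
  have h4 : 2 * C / nn * (C * nn) = 2 * C ^ 2 := by field_simp
  linarith

lemma DH.C_le (H : DH C K δ ε k y nn ℓ σ2 σ2l σ2h σ3l σ4l l m M x xl d dh dC) (r : ℕ)
    (hr : r ≤ M) : M / nn * ∑ i ∈ range r, xl i ^ 3 ≤
      k * (y * nn / ((m : ℝ) - l)) * (ε + 2 * C * δ * K) := by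
  have hC : 0 < C := by linarith [H.C1]
  have hnn := H.nn0
  have hM := H.M0
  have hδ := H.δ0
  have h1 := sum_upper hr (b := 2 * C / nn * σ4l) (by have := H.σ4l0; positivity)
    (H.hCc r hr) fun i hi => (H.dC1 i (by omega)).trans
      (div_bd H.nn0 hC (H.R i (by omega)) le_rfl H.σ4l0)
  have hT : 0 < y * nn / ((m : ℝ) - l) := by
    have := H.y0; have := H.N0; positivity
  have hMT := H.MT
  generalize hTd : y * nn / ((m : ℝ) - l) = T at *
  calc M / nn * ∑ i ∈ range r, xl i ^ 3 ≤
      M / nn * (k * ε * T * (nn / M) + M * (2 * C / nn * σ4l)) := by gcongr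
    _ = k * ε * T + 2 * C * M * (M * σ4l / nn ^ 2) := by field_simp
    _ ≤ k * ε * T + 2 * C * (K * T) * δ := by
        have : M * σ4l / nn ^ 2 ≤ δ := by
          rw [div_le_iff₀ (by positivity)]; exact H.h4
        have hσ4 := H.σ4l0
        have hK1 := H.K1
        gcongr
    _ ≤ _ := by
        have := H.k1
        have h : 0 ≤ 2 * C * (K * T) * δ := by have := H.K1; positivity
        nlinarith

/-- constant -/
noncomputable def D2 (C K : ℝ) : ℝ := 1 + 2 * C * (2 * K + 2 * C ^ 2 * K + 1 + C ^ 2 * K * (2 * C ^ 2 + K))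

lemma DH.rho_le (H : DH C K δ ε k y nn ℓ σ2 σ2l σ2h σ3l σ4l l m M x xl d dh dC) {z : ℝ}
    (hz : z ≤ C * nn) : z / ℓ ≤ C ^ 2 := by
  have hC : 0 < C := by linarith [H.C1]
  have hnn := H.nn0
  have hl : 0 < ℓ := by
    have := H.ℓlo
    by_contra h
    push Not at h
    nlinarith
  rw [div_le_iff₀ hl]
  have := H.ℓlo
  nlinarith

lemma DH.l0 (H : DH C K δ ε k y nn ℓ σ2 σ2l σ2h σ3l σ4l l m M x xl d dh dC) : 0 < ℓ := by
  have hC : 0 < C := by linarith [H.C1]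
  have hnn := H.nn0
  have := H.ℓlo
  by_contra h
  push Not at h
  nlinarith

lemma DH.R0 (H : DH C K δ ε k y nn ℓ σ2 σ2l σ2h σ3l σ4l l m M x xl d dh dC) (r : ℕ)
    (hr : r ≤ M) : 0 < ℓ - ∑ i ∈ range r, x i := by
  have hC : 0 < C := by linarith [H.C1]
  have hnn := H.nn0
  have := H.R r hr
  by_contra h
  push Not at h
  nlinarith

lemma DH.X_close (H : DH C K δ ε k y nn ℓ σ2 σ2l σ2h σ3l σ4l l m M x xl d dh dC) (r : ℕ)
    (hr : r ≤ M) : |∑ i ∈ range r, x i - σ2 / ℓ * r| ≤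
      k * δ * D2 C K * (y * nn / ((m : ℝ) - l)) := by
  have hC : 0 < C := by linarith [H.C1]
  have hnn := H.nn0
  have hM := H.M0
  have hδ := H.δ0
  have hk := H.k1
  have hK := H.K1
  have hε := H.ε0
  have hl := H.l0
  have hT : 0 < y * nn / ((m : ℝ) - l) := by
    have := H.y0; have := H.N0; positivity
  have hX1 : k * ε * y * M / ((m : ℝ) - l) ≤ k * δ * (y * nn / ((m : ℝ) - l)) := by
    have : k * ε * y * M / ((m : ℝ) - l) = k * ε * (M / nn) * (y * nn / ((m : ℝ) - l)) := by
      field_simp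
    rw [this]
    have h1 : M / nn ≤ δ := by rw [div_le_iff₀ hnn]; exact H.Mn
    have h2 : ε * (M / nn) ≤ 1 * δ := by
      have := H.ε1
      gcongr
    rw [mul_assoc k]
    gcongr
    linarith
  have hb : ∀ i, i < r → |d i - σ2 / ℓ| ≤ 2 * C / nn * (2 * σ2h +
      (k * ε * (y * nn / ((m : ℝ) - l)) + M * (2 * C ^ 2)) +
      C ^ 2 * (k * M * (2 * C ^ 2 + K))) := by
    intro i hi
    have hiM : i < M := by omega
    have hR0 := H.R0 i hiM.le
    have hQ0 : 0 ≤ ∑ i ∈ range i, xl i ^ 2 := Finset.sum_nonneg fun i _ => sq_nonneg _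
    have hX0 : 0 ≤ ∑ i ∈ range i, x i := Finset.sum_nonneg fun i _ => H.x0 i
    have hQ := H.Q_le i hiM.le
    have hX := H.X_le i hiM.le
    have hdh := (H.dh1 i hiM).trans (div_bd H.nn0 hC (H.R i hiM.le) le_rfl H.σ2h0)
    have hdh0 := H.dh0 i hiM
    have hRR := H.R i hiM.le
    rw [H.d_eq i hiM]
    have e1 : (σ2l - ∑ i ∈ range i, xl i ^ 2) / (ℓ - ∑ i ∈ range i, x i) + dh i - σ2 / ℓ =
        (-σ2h - ∑ i ∈ range i, xl i ^ 2 + σ2 / ℓ * ∑ i ∈ range i, x i) /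
          (ℓ - ∑ i ∈ range i, x i) + dh i := by
      rw [H.σ2e]
      field_simp
      ring
    rw [e1]
    have hρ := H.rho_le H.σ2C
    have hρ0 : 0 ≤ σ2 / ℓ := by
      have := H.σ2e; have := H.σ2l0; have := H.σ2h0
      have : 0 ≤ σ2 := by linarith
      positivity
    have e2 : |-σ2h - ∑ i ∈ range i, xl i ^ 2 + σ2 / ℓ * ∑ i ∈ range i, x i| ≤
        σ2h + (k * ε * (y * nn / ((m : ℝ) - l)) + M * (2 * C ^ 2)) +
        C ^ 2 * (k * M * (2 * C ^ 2 + K)) := by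
      have h1 : σ2 / ℓ * ∑ i ∈ range i, x i ≤ C ^ 2 * (k * M * (2 * C ^ 2 + K)) := by gcongr
      have h2 : 0 ≤ σ2 / ℓ * ∑ i ∈ range i, x i := by positivity
      have := H.σ2h0
      rw [abs_le]; constructor <;> linarith
    have e3 := div_bd H.nn0 hC hRR e2 (le_trans (abs_nonneg _) e2)
    refine (abs_add_le _ _).trans ?_
    rw [abs_div, abs_of_pos hR0, abs_of_nonneg hdh0]
    calc _ ≤ _ := add_le_add e3 hdh
      _ = _ := by ring
  have hMT := H.MT
  have hfin := sum_close hr (by have := H.σ2h0; positivity) (H.hX r hr) hb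
  refine hfin.trans ?_
  generalize hTd : y * nn / ((m : ℝ) - l) = T at *
  have h1 : M / nn ≤ δ := by rw [div_le_iff₀ hnn]; exact H.Mn
  have h2 : (M : ℝ) * (2 * C / nn * (2 * σ2h + (k * ε * T + M * (2 * C ^ 2)) +
      C ^ 2 * (k * M * (2 * C ^ 2 + K)))) ≤
      2 * C * δ * (k * T * (2 * K + 2 * C ^ 2 * K + 1 + C ^ 2 * K * (2 * C ^ 2 + K))) := by
    have e : (M : ℝ) * (2 * C / nn * (2 * σ2h + (k * ε * T + M * (2 * C ^ 2)) +
      C ^ 2 * (k * M * (2 * C ^ 2 + K)))) = 2 * C * (M / nn) * (2 * σ2h + (k * ε * T + M * (2 * C ^ 2)) +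
      C ^ 2 * (k * M * (2 * C ^ 2 + K))) := by ring
    rw [e]
    have hσ := H.σ2h0
    have hKT : 0 ≤ K * T := by positivity
    have a1 : 2 * σ2h ≤ k * T * (2 * K) := by
      have : σ2h ≤ 1 * (K * T) := H.h2.trans (by have := H.δ1; gcongr)
      nlinarith
    have a2 : k * ε * T ≤ k * T * 1 := by
      have := H.ε1
      have : 0 ≤ k * T := by positivity
      nlinarith
    have a3 : M * (2 * C ^ 2) ≤ k * T * (2 * C ^ 2 * K) := by
      have : M * (2 * C ^ 2) ≤ 1 * ((K * T) * (2 * C ^ 2)) := by rw [one_mul]; gcongr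
      refine this.trans ?_
      have : 1 * ((K * T) * (2 * C ^ 2)) ≤ k * ((K * T) * (2 * C ^ 2)) := by gcongr
      linarith
    have a4 : C ^ 2 * (k * M * (2 * C ^ 2 + K)) ≤ k * T * (C ^ 2 * K * (2 * C ^ 2 + K)) := by
      calc C ^ 2 * (k * M * (2 * C ^ 2 + K)) ≤ C ^ 2 * (k * (K * T) * (2 * C ^ 2 + K)) := by gcongr
        _ = _ := by ring
    have a5 : 2 * σ2h + (k * ε * T + M * (2 * C ^ 2)) + C ^ 2 * (k * M * (2 * C ^ 2 + K)) ≤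
       k * T * (2 * K + 2 * C ^ 2 * K + 1 + C ^ 2 * K * (2 * C ^ 2 + K)) := by linarith
    gcongr
  rw [D2]
  linarith

/-- constant -/
noncomputable def D4 (C K : ℝ) : ℝ := 2 * C * (2 * C * K + C ^ 2 * K * (2 * C ^ 2 + K))

lemma DH.Q_close (H : DH C K δ ε k y nn ℓ σ2 σ2l σ2h σ3l σ4l l m M x xl d dh dC) (r : ℕ)
    (hr : r ≤ M) : |∑ i ∈ range r, xl i ^ 2 - σ3l / ℓ * r| ≤
      k * (ε * (1 + 2 * C) + δ * D4 C K) * (y * nn / ((m : ℝ) - l)) := by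
  have hC : 0 < C := by linarith [H.C1]
  have hnn := H.nn0
  have hM := H.M0
  have hδ := H.δ0
  have hk := H.k1
  have hK := H.K1
  have hε := H.ε0
  have hl := H.l0
  have hT : 0 < y * nn / ((m : ℝ) - l) := by
    have := H.y0; have := H.N0; positivity
  have hMT := H.MT
  have hCM := fun i hi => H.C_le i hi
  have hQm := H.hQ r hr
  generalize hTd : y * nn / ((m : ℝ) - l) = T at *
  have hMn : M / nn ≤ δ := by rw [div_le_iff₀ hnn]; exact H.Mn
  set b := 2 * C / M * (k * T * (ε + 2 * C * δ * K) + C ^ 2 * (δ * (k * (K * T) * (2 * C ^ 2 + K))))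
    with hbdef
  have hb : ∀ i, i < r → |(σ3l - ∑ j ∈ range i, xl j ^ 3) / (ℓ - ∑ j ∈ range i, x j) -
      σ3l / ℓ| ≤ b := by
    intro i hi
    have hiM : i < M := by omega
    have hR0 := H.R0 i hiM.le
    have hQ0 : 0 ≤ ∑ j ∈ range i, xl j ^ 3 := Finset.sum_nonneg fun j _ => pow_nonneg (H.xl0 j) 3
    have hX0 : 0 ≤ ∑ i ∈ range i, x i := Finset.sum_nonneg fun i _ => H.x0 i
    have hQ := hCM i hiM.le
    have hX := H.X_le i hiM.le
    have hRR := H.R i hiM.le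
    have e1 : (σ3l - ∑ j ∈ range i, xl j ^ 3) / (ℓ - ∑ j ∈ range i, x j) - σ3l / ℓ =
        (- ∑ j ∈ range i, xl j ^ 3 + σ3l / ℓ * ∑ i ∈ range i, x i) /
          (ℓ - ∑ i ∈ range i, x i) := by
      field_simp
      ring
    have hρ := H.rho_le H.σ3lC
    have hρ0 : 0 ≤ σ3l / ℓ := div_nonneg H.σ3l0 hl.le
    have e2 : |- ∑ j ∈ range i, xl j ^ 3 + σ3l / ℓ * ∑ i ∈ range i, x i| ≤
        ∑ j ∈ range i, xl j ^ 3 + C ^ 2 * (k * M * (2 * C ^ 2 + K)) := by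
      have h1 : σ3l / ℓ * ∑ i ∈ range i, x i ≤ C ^ 2 * (k * M * (2 * C ^ 2 + K)) := by gcongr
      have h2 : 0 ≤ σ3l / ℓ * ∑ i ∈ range i, x i := by positivity
      rw [abs_le]; constructor <;> linarith
    have e3 := div_bd H.nn0 hC hRR e2 (le_trans (abs_nonneg _) e2)
    rw [e1, abs_div, abs_of_pos hR0]
    refine e3.trans ?_
    have e4 : 2 * C / nn * (∑ j ∈ range i, xl j ^ 3 + C ^ 2 * (k * M * (2 * C ^ 2 + K))) =
      2 * C / M * (M / nn * ∑ j ∈ range i, xl j ^ 3 +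
        C ^ 2 * (M / nn * (k * M * (2 * C ^ 2 + K)))) := by
      field_simp
    rw [e4, hbdef]
    gcongr
  have hb0 : 0 ≤ b := by positivity
  have hfin := sum_close hr hb0 hQm hb
  refine hfin.trans (le_of_eq ?_)
  rw [hbdef, D4]
  field_simp
  ring

/-- deterministic approximation of the drift -/
noncomputable def cc (σ2l σ3l σ2 ℓ : ℝ) (r : ℕ) : ℝ := (σ2l - σ3l / ℓ * r) / (ℓ - σ2 / ℓ * r)

/-- constant -/
noncomputable def D3 (C K : ℝ) : ℝ := 2 * C * D4 C K + 4 * C ^ 3 * D2 C K + 2 * C * K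

lemma DH.d_close (H : DH C K δ ε k y nn ℓ σ2 σ2l σ2h σ3l σ4l l m M x xl d dh dC) (r : ℕ)
    (hr : r < M) : ((m : ℝ) - l) * |d r - cc σ2l σ3l σ2 ℓ r| ≤
      k * y * (2 * C * (1 + 2 * C) * ε + D3 C K * δ) := by
  have hC1 := H.C1
  have hC : 0 < C := by linarith [H.C1]
  have hnn := H.nn0
  have hM := H.M0
  have hδ := H.δ0
  have hk := H.k1
  have hK := H.K1
  have hε := H.ε0
  have hl := H.l0
  have hN := H.N0
  have hy := H.y0
  have hρ := H.rho_le H.σ2C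
  have hq := H.rho_le H.σ3lC
  have hρ0 : 0 ≤ σ2 / ℓ := by
    have := H.σ2e; have := H.σ2l0; have := H.σ2h0
    have : 0 ≤ σ2 := by linarith
    positivity
  have hq0 : 0 ≤ σ3l / ℓ := div_nonneg H.σ3l0 hl.le
  have hrM : (r : ℝ) ≤ M := by exact_mod_cast hr.le
  have hCδ : C ^ 2 * (δ * nn) ≤ nn / (2 * C) := by
    rw [le_div_iff₀ (by positivity)]
    have := H.δ2
    nlinarith
  have hρr : σ2 / ℓ * r ≤ C ^ 2 * (δ * nn) := by
    have := hrM.trans H.Mn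
    gcongr
  have hqr : σ3l / ℓ * r ≤ C ^ 2 * (δ * nn) := by
    have := hrM.trans H.Mn
    gcongr
  have hR' : nn ≤ 2 * C * (ℓ - σ2 / ℓ * r) := by
    have h1 := H.ℓlo
    have h2 : 2 * C * (nn / (2 * C)) = nn := by field_simp
    have h3 : 2 * C * (σ2 / ℓ * r) ≤ 2 * C * (nn / (2 * C)) := by gcongr; linarith
    nlinarith
  have hR'0 : 0 < ℓ - σ2 / ℓ * r := by
    by_contra h
    push Not at h
    nlinarith
  have hA' : |σ2l - σ3l / ℓ * r| ≤ C * nn := by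
    have h1 : 0 ≤ σ3l / ℓ * r := by positivity
    have h2 : nn / (2 * C) ≤ C * nn := by
      rw [div_le_iff₀ (by positivity)]
      have : 1 ≤ C * C := by nlinarith
      nlinarith
    have := H.σ2C; have := H.σ2e; have := H.σ2h0; have := H.σ2l0
    rw [abs_le]; constructor <;> linarith
  have hR0 := H.R0 r hr.le
  have hRR := H.R r hr.le
  have hXc := H.X_close r hr.le
  have hQc := H.Q_close r hr.le
  have hdh := (H.dh1 r hr).trans (div_bd H.nn0 hC hRR le_rfl H.σ2h0)
  have hdh0 := H.dh0 r hr
  have hNT : ((m : ℝ) - l) * (y * nn / ((m : ℝ) - l)) = y * nn := by field_simp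
  have hT0 : 0 < y * nn / ((m : ℝ) - l) := by positivity
  rw [H.d_eq r hr, cc]
  generalize hTd : y * nn / ((m : ℝ) - l) = T at *
  generalize hXd : ∑ i ∈ range r, x i = X at *
  generalize hQd : ∑ i ∈ range r, xl i ^ 2 = Q at *
  have e1 : (σ2l - Q) / (ℓ - X) + dh r - (σ2l - σ3l / ℓ * r) / (ℓ - σ2 / ℓ * r) =
      -(Q - σ3l / ℓ * r) / (ℓ - X) +
      (σ2l - σ3l / ℓ * r) * ((X - σ2 / ℓ * r) / (ℓ - X) / (ℓ - σ2 / ℓ * r)) + dh r := by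
    generalize σ3l / ℓ * r = a at *
    generalize σ2 / ℓ * r = a' at *
    field_simp
    ring
  have f1 : |-(Q - σ3l / ℓ * r) / (ℓ - X)| ≤ 2 * C / nn * (k * (ε * (1 + 2 * C) + δ * D4 C K) * T) := by
    rw [abs_div, abs_neg, abs_of_pos hR0]
    exact div_bd hnn hC hRR hQc ((abs_nonneg _).trans hQc)
  have f2 : |(X - σ2 / ℓ * r) / (ℓ - X) / (ℓ - σ2 / ℓ * r)| ≤
      2 * C / nn * (2 * C / nn * (k * δ * D2 C K * T)) := by
    rw [abs_div, abs_of_pos hR'0, abs_div, abs_of_pos hR0]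
    have := div_bd hnn hC hRR hXc ((abs_nonneg _).trans hXc)
    have h0 : 0 ≤ 2 * C / nn * (k * δ * D2 C K * T) :=
      mul_nonneg (by positivity) ((abs_nonneg _).trans hXc)
    exact div_bd hnn hC hR' this h0
  have f3 : |(σ2l - σ3l / ℓ * r) * ((X - σ2 / ℓ * r) / (ℓ - X) / (ℓ - σ2 / ℓ * r))| ≤
      C * nn * (2 * C / nn * (2 * C / nn * (k * δ * D2 C K * T))) := by
    rw [abs_mul]
    exact mul_le_mul hA' f2 (abs_nonneg _) (by positivity)
  rw [e1]
  have f4 := abs_add_le (-(Q - σ3l / ℓ * r) / (ℓ - X) +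
      (σ2l - σ3l / ℓ * r) * ((X - σ2 / ℓ * r) / (ℓ - X) / (ℓ - σ2 / ℓ * r))) (dh r)
  have f5 := abs_add_le (-(Q - σ3l / ℓ * r) / (ℓ - X))
      ((σ2l - σ3l / ℓ * r) * ((X - σ2 / ℓ * r) / (ℓ - X) / (ℓ - σ2 / ℓ * r)))
  rw [abs_of_nonneg hdh0] at f4
  have f6 := (f4.trans (add_le_add_left (f5.trans (add_le_add f1 f3)) _)).trans
    (add_le_add_right hdh _)
  have f7 := mul_le_mul_of_nonneg_left f6 hN.le
  refine f7.trans ?_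
  have g1 : ((m : ℝ) - l) * (2 * C / nn * σ2h) ≤ k * y * (2 * C * K * δ) := by
    have : ((m : ℝ) - l) * σ2h ≤ δ * (K * y * nn) := by
      calc ((m : ℝ) - l) * σ2h ≤ ((m : ℝ) - l) * (δ * M) := by have := H.h2; gcongr
        _ = δ * (((m : ℝ) - l) * M) := by ring
        _ ≤ _ := by have := H.NM; gcongr
    calc ((m : ℝ) - l) * (2 * C / nn * σ2h) = 2 * C / nn * (((m : ℝ) - l) * σ2h) := by ring
      _ ≤ 2 * C / nn * (δ * (K * y * nn)) := by gcongr
      _ = 1 * (y * (2 * C * K * δ)) := by field_simp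
      _ ≤ k * (y * (2 * C * K * δ)) := by gcongr
      _ = _ := by ring
  have g2 : ((m : ℝ) - l) * (2 * C / nn * (k * (ε * (1 + 2 * C) + δ * D4 C K) * T) +
      C * nn * (2 * C / nn * (2 * C / nn * (k * δ * D2 C K * T)))) =
      k * y * (2 * C * (1 + 2 * C) * ε + (2 * C * D4 C K + 4 * C ^ 3 * D2 C K) * δ) := by
    have : ((m : ℝ) - l) * (2 * C / nn * (k * (ε * (1 + 2 * C) + δ * D4 C K) * T) +
      C * nn * (2 * C / nn * (2 * C / nn * (k * δ * D2 C K * T)))) =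
      (((m : ℝ) - l) * T) * (2 * C / nn * (k * (ε * (1 + 2 * C) + δ * D4 C K)) +
      C * nn * (2 * C / nn * (2 * C / nn * (k * δ * D2 C K)))) := by ring
    rw [this, hNT]
    field_simp
    ring
  rw [mul_add, g2, D3]
  linarith

lemma DH.win_close (H : DH C K δ ε k y nn ℓ σ2 σ2l σ2h σ3l σ4l l m M x xl d dh dC) (i j : ℕ)
    (hi : l ≤ i) (hij : i ≤ j) (hj : j ≤ m) :
    |∑ r ∈ Ico i j, (x r - cc σ2l σ3l σ2 ℓ r)| ≤
      k * y * (2 * ε + (2 * C * (1 + 2 * C) * ε + D3 C K * δ)) := by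
  have hN := H.N0
  have e1 : ∑ r ∈ Ico i j, (x r - cc σ2l σ3l σ2 ℓ r) =
      (∑ r ∈ Ico l j, (x r - d r) - ∑ r ∈ Ico l i, (x r - d r)) +
      ∑ r ∈ Ico i j, (d r - cc σ2l σ3l σ2 ℓ r) := by
    rw [← Finset.sum_Ico_consecutive (fun r => x r - d r) hi hij, add_sub_cancel_left,
      ← Finset.sum_add_distrib]
    exact Finset.sum_congr rfl fun r _ => by ring
  set b := k * y * (2 * C * (1 + 2 * C) * ε + D3 C K * δ) with hb
  have e2 : |∑ r ∈ Ico i j, (d r - cc σ2l σ3l σ2 ℓ r)| ≤ b := by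
    refine (Finset.abs_sum_le_sum_abs _ _).trans ?_
    have h1 : ∀ r ∈ Ico i j, |d r - cc σ2l σ3l σ2 ℓ r| ≤ b / ((m : ℝ) - l) := by
      intro r hr
      have hr := mem_Ico.1 hr
      rw [le_div_iff₀ hN, mul_comm]
      exact H.d_close r (by have := H.mM; omega)
    refine (Finset.sum_le_card_nsmul _ _ _ h1).trans ?_
    rw [Nat.card_Ico, nsmul_eq_mul, Nat.cast_sub hij]
    have hb0 : 0 ≤ b := by
      have h0 := H.d_close l (by have := H.mM; have := H.lm; omega)
      exact le_trans (by positivity) h0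
    rw [← mul_div_assoc, div_le_iff₀ hN, mul_comm]
    have a1 : (j : ℝ) ≤ m := by exact_mod_cast hj
    have a2 : (l : ℝ) ≤ i := by exact_mod_cast hi
    gcongr
  have e3 := H.hW j (hi.trans hij) hj
  have e4 := H.hW i hi (hij.trans hj)
  rw [e1]
  refine (abs_add_le _ _).trans ?_
  have e5 := abs_sub (∑ r ∈ Ico l j, (x r - d r)) (∑ r ∈ Ico l i, (x r - d r))
  linarith

lemma DH.win_le (H : DH C K δ ε k y nn ℓ σ2 σ2l σ2h σ3l σ4l l m M x xl d dh dC) (i j : ℕ)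
    (hi : l ≤ i) (hij : i ≤ j) (hj : j ≤ m) :
    ∑ r ∈ Ico i j, x r ≤ 2 * k * ((m : ℝ) - l) * (2 * C ^ 2 + K) := by
  have hN := H.N0
  have hk := H.k1
  have h0 : ∑ r ∈ Ico i j, x r ≤ ∑ r ∈ Ico l m, x r :=
    Finset.sum_le_sum_of_subset_of_nonneg (Finset.Ico_subset_Ico hi hj) fun r _ _ => H.x0 r
  have h1 : ∑ r ∈ Ico l m, x r = ∑ r ∈ Ico l m, (x r - d r) + ∑ r ∈ Ico l m, d r := by
    simp [Finset.sum_sub_distrib]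
  have h2 : ∑ r ∈ Ico l m, d r ≤ ((m : ℝ) - l) * (2 * C ^ 2) := by
    refine (Finset.sum_le_card_nsmul _ _ (2 * C ^ 2) fun r hr => H.d_le r ?_).trans ?_
    · have := mem_Ico.1 hr; have := H.mM; omega
    · rw [Nat.card_Ico, nsmul_eq_mul, Nat.cast_sub H.lm.le]
  have h3 := (le_abs_self _).trans (H.hW m H.lm.le le_rfl)
  have h4 : k * ε * y ≤ k * (1 * (K * ((m : ℝ) - l))) := by
    have := H.ε1; have := H.yN; have := H.y0
    rw [mul_assoc]
    gcongr
  have h5 : ((m : ℝ) - l) * (2 * C ^ 2) ≤ k * (((m : ℝ) - l) * (2 * C ^ 2)) :=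
    le_mul_of_one_le_left (by positivity) hk
  have h6 : 0 ≤ k * (((m : ℝ) - l) * (2 * C ^ 2)) := by positivity
  have h7 : 0 ≤ k * (1 * (K * ((m : ℝ) - l))) := by have := H.K1; positivity
  nlinarith

end

lemma abel {β u : ℕ → ℝ} {D : ℝ} {i : ℕ} (hβ0 : ∀ r, 0 ≤ β r)
    (hβ : ∀ r, β (r + 1) ≤ β r) (j : ℕ) (hij : i ≤ j)
    (hD : ∀ s, i ≤ s → s ≤ j → |∑ r ∈ Ico i s, u r| ≤ D) :
    |∑ r ∈ Ico i j, β r * u r| ≤ β i * D := by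
  have key : ∀ d, i + d ≤ j → |∑ r ∈ Ico i (i + d), β r * u r -
      β (i + d) * ∑ r ∈ Ico i (i + d), u r| ≤ (β i - β (i + d)) * D := by
    intro d
    induction d with
    | zero => intro _; simp
    | succ d ih =>
      intro hd
      have ih := ih (by omega)
      have h1 := hD (i + (d + 1)) (by omega) hd
      have e : i + (d + 1) = (i + d) + 1 := by omega
      rw [e] at h1 ⊢
      have e2 : ∑ r ∈ Ico i (i + d + 1), β r * u r - β (i + d + 1) * ∑ r ∈ Ico i (i + d + 1), u r =
          (∑ r ∈ Ico i (i + d), β r * u r - β (i + d) * ∑ r ∈ Ico i (i + d), u r) +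
          (β (i + d) - β (i + d + 1)) * ∑ r ∈ Ico i (i + d + 1), u r := by
        rw [Finset.sum_Ico_succ_top (by omega), Finset.sum_Ico_succ_top (by omega)]
        ring
      rw [e2]
      refine (abs_add_le _ _).trans ?_
      rw [abs_mul, abs_of_nonneg (sub_nonneg.2 (hβ (i + d)))]
      have := mul_le_mul_of_nonneg_left h1 (sub_nonneg.2 (hβ (i + d)))
      linarith
  obtain ⟨d, rfl⟩ := Nat.exists_eq_add_of_le hij
  have h1 := key d le_rfl
  have h2 := mul_le_mul_of_nonneg_left (hD (i + d) hij le_rfl) (hβ0 (i + d))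
  have h3 : ∑ r ∈ Ico i (i + d), β r * u r = (∑ r ∈ Ico i (i + d), β r * u r -
      β (i + d) * ∑ r ∈ Ico i (i + d), u r) + β (i + d) * ∑ r ∈ Ico i (i + d), u r := by ring
  rw [h3]
  refine (abs_add_le _ _).trans ?_
  rw [abs_mul, abs_of_nonneg (hβ0 _)]
  linarith

end DPC

namespace DPC
open Finset

/-- constant -/
noncomputable def D5 (C K : ℝ) : ℝ := 2 * C ^ 2 + K

/-- the deterministic slope -/
noncomputable def beta (p ℓ σ2 : ℝ) (h r : ℕ) : ℝ := p * max (ℓ - σ2 / ℓ * ((r + h + 1 : ℕ) : ℝ)) 0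

set_option maxHeartbeats 2000000 in
lemma DH.det {C K δ ε k y nn ℓ σ2 σ2l σ2h σ3l σ4l : ℝ} {l m M h : ℕ} {x xl d dh dC : ℕ → ℝ}
    (H : DH C K δ ε k y nn ℓ σ2 σ2l σ2h σ3l σ4l l m M x xl d dh dC)
    {p cn : ℝ} {G : ℕ → ℝ} (hM : M = m + h) (hp0 : 0 ≤ p) (hp : p * ℓ ≤ 2)
    (hcn : 0 ≤ cn) (hcy : cn ≤ y) (hx : ∀ r, x r ≤ δ * cn)
    (hGu : ∀ r, r < m → G r ≤ p * x r * (ℓ - ∑ i ∈ range (r + h + 1), x i))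
    (hGl : ∀ r, r < m → p * x r * (ℓ - ∑ i ∈ range (r + h + 1), x i) - p ^ 2 * x r ^ 2 * σ2 ≤ G r)
    (hδ3 : D3 C K * δ ≤ ε) (hδ4 : 4 * C * D5 C K * D2 C K * δ ≤ ε)
    (hδ5 : 8 * C ^ 3 * D5 C K * δ ≤ ε) (i j : ℕ) (hi : l ≤ i) (hij : i ≤ j) (hj : j ≤ m) :
    |∑ r ∈ Ico i j, G r - ∑ r ∈ Ico i j, beta p ℓ σ2 h r * cc σ2l σ3l σ2 ℓ r| ≤
      20 * C ^ 2 * ε * k ^ 2 * y := by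
  have hC1 := H.C1
  have hC : 0 < C := by linarith [H.C1]
  have hnn := H.nn0
  have hM0 := H.M0
  have hδ := H.δ0
  have hk := H.k1
  have hK := H.K1
  have hε := H.ε0
  have hl := H.l0
  have hN := H.N0
  have hy := H.y0
  have hρ := H.rho_le H.σ2C
  have hσ20 : 0 ≤ σ2 := by
    have := H.σ2e; have := H.σ2l0; have := H.σ2h0
    linarith
  have hρ0 : 0 ≤ σ2 / ℓ := by positivity
  have hpn : p * nn ≤ 2 * C := by
    calc p * nn ≤ p * (C * ℓ) := by have := H.ℓlo; gcongr
      _ = C * (p * ℓ) := by ring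
      _ ≤ C * 2 := by gcongr
      _ = _ := by ring
  have hNn : (m : ℝ) - l ≤ nn := by
    have h1 : (m : ℝ) ≤ M := by exact_mod_cast H.mM
    have h2 : (0 : ℝ) ≤ l := by positivity
    have h3 := H.Mn
    have h4 : δ * nn ≤ 1 * nn := by have := H.δ1; gcongr
    linarith
  -- first part
  have hβ0 : ∀ r, 0 ≤ beta p ℓ σ2 h r := fun r => mul_nonneg hp0 (le_max_right _ _)
  have hβ1 : ∀ r, beta p ℓ σ2 h (r + 1) ≤ beta p ℓ σ2 h r := by
    intro r
    unfold beta
    have : (((r + h + 1 : ℕ) : ℝ)) ≤ ((r + 1 + h + 1 : ℕ) : ℝ) := by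
      exact_mod_cast (by omega)
    gcongr
  have hβ2 : ∀ r, beta p ℓ σ2 h r ≤ 2 := by
    intro r
    refine le_trans ?_ hp
    unfold beta
    have : max (ℓ - σ2 / ℓ * ((r + h + 1 : ℕ) : ℝ)) 0 ≤ ℓ := by
      apply max_le _ hl.le
      have : 0 ≤ σ2 / ℓ * ((r + h + 1 : ℕ) : ℝ) := by positivity
      linarith
    gcongr
  have hβe : ∀ r, r < m → beta p ℓ σ2 h r = p * (ℓ - σ2 / ℓ * ((r + h + 1 : ℕ) : ℝ)) := by
    intro r hr
    unfold beta
    rw [max_eq_left]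
    have h1 : ((r + h + 1 : ℕ) : ℝ) ≤ M := by exact_mod_cast (by omega)
    have h2 : σ2 / ℓ * ((r + h + 1 : ℕ) : ℝ) ≤ C ^ 2 * (δ * nn) := by
      have := h1.trans H.Mn
      gcongr
    have h3 : C ^ 2 * (δ * nn) ≤ C ^ 2 * (δ * (C * ℓ)) := by have := H.ℓlo; gcongr
    have h4 := H.δ2
    have : C ^ 2 * (δ * (C * ℓ)) ≤ ℓ := by nlinarith
    linarith
  set W := k * y * (2 * ε + (2 * C * (1 + 2 * C) * ε + D3 C K * δ)) with hW
  have A1 : |∑ r ∈ Ico i j, beta p ℓ σ2 h r * (x r - cc σ2l σ3l σ2 ℓ r)| ≤ 2 * W := by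
    have h1 := abel (u := fun r => x r - cc σ2l σ3l σ2 ℓ r) hβ0 hβ1 j hij
      (D := W) fun s hs hsj => H.win_close i s hi hs (hsj.trans hj)
    have hW0 : 0 ≤ W := (abs_nonneg _).trans (H.win_close i i hi le_rfl (hij.trans hj))
    exact h1.trans (mul_le_mul_of_nonneg_right (hβ2 i) hW0)
  have hD2 : 0 ≤ D2 C K := by unfold D2; positivity
  have hD5 : 0 ≤ D5 C K := by unfold D5; positivity
  set T := y * nn / ((m : ℝ) - l) with hT
  have hT0 : 0 ≤ T := by positivity
  have A2 : |∑ r ∈ Ico i j, (G r - beta p ℓ σ2 h r * x r)| ≤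
      2 * k * ((m : ℝ) - l) * D5 C K * (p * (k * δ * D2 C K * T) + p ^ 2 * (δ * cn) * σ2) := by
    refine (Finset.abs_sum_le_sum_abs _ _).trans ?_
    have h1 : ∀ r ∈ Ico i j, |G r - beta p ℓ σ2 h r * x r| ≤
        x r * (p * (k * δ * D2 C K * T) + p ^ 2 * (δ * cn) * σ2) := by
      intro r hr
      have hr := mem_Ico.1 hr
      have hrm : r < m := by omega
      have hx0 := H.x0 r
      have hXc := abs_le.1 (H.X_close (r + h + 1) (by omega))
      have u := hGu r hrm
      have lo := hGl r hrm
      rw [hβe r hrm]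
      have px : 0 ≤ p * x r := by positivity
      have z : p ^ 2 * x r ^ 2 * σ2 ≤ x r * (p ^ 2 * (δ * cn) * σ2) := by
        calc p ^ 2 * x r ^ 2 * σ2 = x r * (p ^ 2 * x r * σ2) := by ring
          _ ≤ _ := by have := hx r; gcongr
      have z1 := mul_le_mul_of_nonneg_left hXc.1 px
      have z2 := mul_le_mul_of_nonneg_left hXc.2 px
      have z3 : 0 ≤ x r * (p ^ 2 * (δ * cn) * σ2) := by positivity
      rw [abs_le]
      constructor <;> nlinarith
    refine (Finset.sum_le_sum h1).trans ?_
    rw [← Finset.sum_mul]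
    have h2 := H.win_le i j hi hij hj
    have : 0 ≤ p * (k * δ * D2 C K * T) + p ^ 2 * (δ * cn) * σ2 := by positivity
    rw [← D5] at h2
    gcongr
  have A3 : 2 * k * ((m : ℝ) - l) * D5 C K * (p * (k * δ * D2 C K * T) + p ^ 2 * (δ * cn) * σ2) ≤
      ε * k ^ 2 * y + ε * k * y := by
    have hNT : ((m : ℝ) - l) * T = y * nn := by rw [hT]; field_simp
    have e : 2 * k * ((m : ℝ) - l) * D5 C K * (p * (k * δ * D2 C K * T) + p ^ 2 * (δ * cn) * σ2) =
      2 * k ^ 2 * D5 C K * D2 C K * δ * y * (p * nn) +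
      2 * k * D5 C K * δ * cn * (((m : ℝ) - l) * σ2 * p ^ 2) := by
      calc _ = 2 * k ^ 2 * D5 C K * D2 C K * δ * p * (((m : ℝ) - l) * T) +
        2 * k * D5 C K * δ * cn * (((m : ℝ) - l) * σ2 * p ^ 2) := by ring
        _ = _ := by rw [hNT]; ring
    rw [e]
    have f1 : ((m : ℝ) - l) * σ2 * p ^ 2 ≤ 4 * C ^ 3 := by
      calc ((m : ℝ) - l) * σ2 * p ^ 2 ≤ nn * (C * nn) * p ^ 2 := by have := H.σ2C; gcongr
        _ = C * (p * nn) ^ 2 := by ring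
        _ ≤ C * (2 * C) ^ 2 := by gcongr
        _ = _ := by ring
    have g1 : 2 * k ^ 2 * D5 C K * D2 C K * δ * y * (p * nn) ≤ ε * k ^ 2 * y := by
      calc _ ≤ 2 * k ^ 2 * D5 C K * D2 C K * δ * y * (2 * C) := by gcongr
        _ = (4 * C * D5 C K * D2 C K * δ) * k ^ 2 * y := by ring
        _ ≤ _ := by gcongr
    have g2 : 2 * k * D5 C K * δ * cn * (((m : ℝ) - l) * σ2 * p ^ 2) ≤ ε * k * y := by
      calc _ ≤ 2 * k * D5 C K * δ * y * (4 * C ^ 3) := by gcongr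
        _ = (8 * C ^ 3 * D5 C K * δ) * k * y := by ring
        _ ≤ _ := by gcongr
    linarith
  have e0 : ∑ r ∈ Ico i j, G r - ∑ r ∈ Ico i j, beta p ℓ σ2 h r * cc σ2l σ3l σ2 ℓ r =
      ∑ r ∈ Ico i j, beta p ℓ σ2 h r * (x r - cc σ2l σ3l σ2 ℓ r) +
      ∑ r ∈ Ico i j, (G r - beta p ℓ σ2 h r * x r) := by
    rw [← Finset.sum_sub_distrib, ← Finset.sum_add_distrib]
    exact Finset.sum_congr rfl fun r _ => by ring
  rw [e0]
  refine (abs_add_le _ _).trans ?_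
  refine (add_le_add A1 (A2.trans A3)).trans ?_
  have kk : k * y ≤ k ^ 2 * y := by
    have : k ≤ k ^ 2 := by nlinarith
    gcongr
  have B1 : 2 * W ≤ k * y * (18 * C ^ 2 * ε) := by
    rw [hW]
    have : 2 * (2 * ε + (2 * C * (1 + 2 * C) * ε + D3 C K * δ)) ≤ 18 * C ^ 2 * ε := by
      have : 1 ≤ C ^ 2 := by nlinarith
      have : C ≤ C ^ 2 := by nlinarith
      nlinarith
    have ky : 0 ≤ k * y := by positivity
    nlinarith
  have B2 : k * y * (18 * C ^ 2 * ε) ≤ k ^ 2 * y * (18 * C ^ 2 * ε) := by gcongr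
  have B3 : ε * k * y ≤ ε * (k ^ 2 * y) := by rw [mul_assoc]; gcongr
  have B4 : ε * (k ^ 2 * y) ≤ C ^ 2 * (ε * (k ^ 2 * y)) := by
    apply le_mul_of_one_le_left (by positivity); nlinarith
  linarith

end DPC

namespace DPC
open Finset

noncomputable section

/-- truncated weights, light part -/
def wl {n : ℕ} (w : Fin n → ℝ) (B : ℝ) (k : Fin n) : ℝ := if w k ≤ B then w k else 0
/-- truncated weights, heavy part -/
def wh {n : ℕ} (w : Fin n → ℝ) (B : ℝ) (k : Fin n) : ℝ := if w k ≤ B then 0 else w k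

/-- hypotheses for fixed `n` -/
structure FH (C K δ ε c0 y cn p : ℝ) {n : ℕ} (w : Fin n → ℝ) (l m h : ℕ) : Prop where
  n0 : 0 < n
  hw : ∀ i, 0 < w i
  C1 : 1 ≤ C
  K1 : 1 ≤ K
  δ0 : 0 ≤ δ
  δ1 : δ ≤ 1
  δs : 4 * C ^ 3 * δ ≤ 1
  ε0 : 0 < ε
  ε1 : ε ≤ 1
  εC : 160 * C ^ 2 * ε ≤ 1
  c00 : 0 < c0
  c01 : 8 * C ^ 2 * c0 ≤ ε ^ 2
  c02 : 2 * c0 * δ ≤ ε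
  δ3 : D3 C K * δ ≤ ε
  δ4 : 4 * C * D5 C K * D2 C K * δ ≤ ε
  δ5 : 8 * C ^ 3 * D5 C K * δ ≤ ε
  y0 : 0 < y
  lm : l < m
  cn0 : 0 < cn
  cny : cn ≤ y
  ℓlo : (n : ℝ) ≤ C * ∑ k, w k
  s2 : ∑ k, w k ^ 2 ≤ C * n
  s3 : ∑ k, w k ^ 3 ≤ C * n
  yN : y ≤ K * ((m : ℝ) - l)
  NM : ((m : ℝ) - l) * ((m + h : ℕ) : ℝ) ≤ K * y * n
  Mn : ((m + h : ℕ) : ℝ) ≤ δ * n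
  h2 : ∑ k, wh w (n / ((m + h : ℕ) : ℝ)) k ^ 2 ≤ δ * ((m + h : ℕ) : ℝ)
  h4 : ((m + h : ℕ) : ℝ) * ∑ k, wl w (n / ((m + h : ℕ) : ℝ)) k ^ 4 ≤ δ * (n : ℝ) ^ 2
  wmax : ∀ i, w i ≤ δ * cn
  p0 : 0 ≤ p
  pl : p * ∑ k, w k ≤ 2
  Λ64 : 64 ≤ Real.exp (c0 * y ^ 2 / (y * cn + ((m : ℝ) - l)))

lemma xs_pow {n : ℕ} (g : Fin n → ℝ) (σ : Fin n → Fin n) (r j : ℕ) (hj : j ≠ 0) :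
    xs (fun k => g k ^ j) σ r = xs g σ r ^ j := by
  unfold xs; split_ifs <;> simp [hj]

lemma xs_nonneg {n : ℕ} {g : Fin n → ℝ} (hg : ∀ k, 0 ≤ g k) (σ : Fin n → Fin n) (r : ℕ) :
    0 ≤ xs g σ r := by
  unfold xs; split_ifs <;> simp [hg]

lemma sum_xs_le {n : ℕ} {g : Fin n → ℝ} (hg : ∀ k, 0 ≤ g k) (σ : Equiv.Perm (Fin n)) (r : ℕ)
    (hr : r ≤ n) : ∑ i ∈ range r, xs g σ i ≤ ∑ k, g k := by
  have h := total_sub g σ r hr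
  have : 0 ≤ ∑ k ∈ Finset.univ.filter (fun k : Fin n => r ≤ (k : ℕ)), g (σ k) :=
    Finset.sum_nonneg fun k _ => hg _
  linarith

section
variable {C K δ ε c0 y cn p : ℝ} {n : ℕ} {w : Fin n → ℝ} {l m h : ℕ}

lemma FH.Mlen (H : FH C K δ ε c0 y cn p w l m h) : m + h ≤ n := by
  have h1 := H.Mn
  have h2 : δ * (n : ℝ) ≤ 1 * n := by have := H.δ1; gcongr
  have : ((m + h : ℕ) : ℝ) ≤ n := by linarith
  exact_mod_cast this

lemma FH.Mpos (H : FH C K δ ε c0 y cn p w l m h) : 0 < ((m + h : ℕ) : ℝ) := by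
  have : 0 < m + h := by have := H.lm; omega
  exact_mod_cast this

lemma FH.Npos (H : FH C K δ ε c0 y cn p w l m h) : 0 < (m : ℝ) - l := by
  have : (l : ℝ) < m := by exact_mod_cast H.lm
  linarith

lemma FH.R (H : FH C K δ ε c0 y cn p w l m h) (σ : Equiv.Perm (Fin n)) (r : ℕ)
    (hr : r ≤ m + h) : (n : ℝ) ≤ 2 * C * ((∑ k, w k) - ∑ i ∈ range r, xs w σ i) := by
  have hC : 0 < C := by linarith [H.C1]
  have hn : (0 : ℝ) < n := by exact_mod_cast H.n0
  have h1 : (∑ i ∈ range r, xs w σ i) ^ 2 ≤ r * ∑ i ∈ range r, xs w σ i ^ 2 := by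
    have := sq_sum_le_card_mul_sum_sq (s := range r) (f := fun i => xs w σ i)
    simpa using this
  have h2 : ∑ i ∈ range r, xs w σ i ^ 2 ≤ ∑ k, w k ^ 2 := by
    have := sum_xs_le (g := fun k => w k ^ 2) (fun k => sq_nonneg _) σ r (hr.trans H.Mlen)
    simpa only [xs_pow w σ _ 2 two_ne_zero] using this
  have hrM : (r : ℝ) ≤ δ * n := le_trans (by exact_mod_cast hr) H.Mn
  have h0 : 0 ≤ ∑ i ∈ range r, xs w σ i := Finset.sum_nonneg fun i _ =>
    xs_nonneg (fun k => (H.hw k).le) _ _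
  have hδ := H.δ0
  have h3 : (∑ i ∈ range r, xs w σ i) ^ 2 ≤ δ * n * (C * n) := by
    refine h1.trans ?_
    have := h2.trans H.s2
    have : 0 ≤ ∑ i ∈ range r, xs w σ i ^ 2 := Finset.sum_nonneg fun i _ => sq_nonneg _
    gcongr
  have h4 : 2 * C * ∑ i ∈ range r, xs w σ i ≤ n := by
    apply le_of_sq_le_sq _ hn.le
    calc (2 * C * ∑ i ∈ range r, xs w σ i) ^ 2 = 4 * C ^ 2 * (∑ i ∈ range r, xs w σ i) ^ 2 := by ring
      _ ≤ 4 * C ^ 2 * (δ * n * (C * n)) := by gcongr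
      _ = (4 * C ^ 3 * δ) * n ^ 2 := by ring
      _ ≤ 1 * n ^ 2 := by have := H.δs; gcongr
      _ = _ := by ring
  have := H.ℓlo
  linarith

/-- good event -/
def Good {n : ℕ} (w : Fin n → ℝ) (ε y : ℝ) (l m h : ℕ) (k : ℕ) (σ : Fin n → Fin n) : Prop :=
  (∀ s, s ≤ m + h → |SS w w 0 s σ| ≤ k * (ε * y * (((m + h : ℕ) : ℝ) / ((m : ℝ) - l)))) ∧
  (∀ s, s ≤ m + h → |SS w (fun i => (n / ((m + h : ℕ) : ℝ))⁻¹ *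
    wl w (n / ((m + h : ℕ) : ℝ)) i ^ 2) 0 s σ| ≤
      k * (ε * y * (((m + h : ℕ) : ℝ) / ((m : ℝ) - l)))) ∧
  (∀ s, s ≤ m + h → |SS w (fun i => ((n / ((m + h : ℕ) : ℝ)) ^ 2)⁻¹ *
    wl w (n / ((m + h : ℕ) : ℝ)) i ^ 3) 0 s σ| ≤
      k * (ε * y * (((m + h : ℕ) : ℝ) / ((m : ℝ) - l)))) ∧
  (∀ s, l ≤ s → s ≤ m → |SS w w l s σ| ≤ k * (ε * y * 1))

lemma cnd_le {w g : Fin n → ℝ} (hw : ∀ i, 0 < w i) (hg : ∀ i, 0 ≤ g i) (σ : Equiv.Perm (Fin n))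
    (r : ℕ) (hr : r < n) :
    cnd w g σ r ≤ (∑ k, w k * g k) / ((∑ k, w k) - ∑ i ∈ Finset.range r, xs w σ i) := by
  unfold cnd
  have h1 := rem_pos hw σ r hr
  have h2 : 0 ≤ ∑ i ∈ Finset.range r, xs (fun k => w k * g k) σ i :=
    Finset.sum_nonneg fun i _ => xs_nonneg (fun k => mul_nonneg (hw k).le (hg k)) _ _
  apply div_le_div_of_nonneg_right _ h1.le
  linarith

lemma cnd_nonneg {w g : Fin n → ℝ} (hw : ∀ i, 0 < w i) (hg : ∀ i, 0 ≤ g i)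
    (σ : Equiv.Perm (Fin n)) (r : ℕ) (hr : r < n) : 0 ≤ cnd w g σ r := by
  unfold cnd
  have h1 := rem_pos hw σ r hr
  have h2 := sum_xs_le (g := fun k => w k * g k) (fun k => mul_nonneg (hw k).le (hg k)) σ r hr.le
  exact div_nonneg (by linarith) h1.le

lemma FH.dh (H : FH C K δ ε c0 y cn p w l m h) (σ : Equiv.Perm (Fin n)) (k : ℕ) (hk : 1 ≤ k)
    (hG : Good w ε y l m h k σ) :
    DH C K δ ε k y n (∑ i, w i) (∑ i, w i ^ 2) (∑ i, wl w (n / ((m + h : ℕ) : ℝ)) i ^ 2)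
      (∑ i, wh w (n / ((m + h : ℕ) : ℝ)) i ^ 2) (∑ i, wl w (n / ((m + h : ℕ) : ℝ)) i ^ 3)
      (∑ i, wl w (n / ((m + h : ℕ) : ℝ)) i ^ 4) l m (m + h) (xs w σ)
      (xs (wl w (n / ((m + h : ℕ) : ℝ))) σ) (cnd w w σ)
      (cnd w (wh w (n / ((m + h : ℕ) : ℝ))) σ)
      (cnd w (fun i => wl w (n / ((m + h : ℕ) : ℝ)) i ^ 3) σ) := by
  have hn : (0 : ℝ) < n := by exact_mod_cast H.n0
  have hM := H.Mpos
  have hN := H.Npos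
  have hMn := H.Mlen
  set B : ℝ := n / ((m + h : ℕ) : ℝ) with hB
  have hB0 : 0 < B := by positivity
  have hw := H.hw
  have hwl0 : ∀ i, 0 ≤ wl w B i := fun i => by unfold wl; split_ifs; exacts [(hw i).le, le_rfl]
  have hwh0 : ∀ i, 0 ≤ wh w B i := fun i => by unfold wh; split_ifs; exacts [le_rfl, (hw i).le]
  have hwle : ∀ i, wl w B i ≤ w i := fun i => by
    unfold wl; split_ifs; exacts [le_rfl, (hw i).le]
  have e2 : ∀ i, w i * wl w B i = wl w B i ^ 2 := fun i => by
    unfold wl; split_ifs <;> ring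
  have e3 : ∀ i, w i * wl w B i ^ 2 = wl w B i ^ 3 := fun i => by
    unfold wl; split_ifs <;> ring
  have e4 : ∀ i, w i * wl w B i ^ 3 = wl w B i ^ 4 := fun i => by
    unfold wl; split_ifs <;> ring
  have eh : ∀ i, w i * wh w B i = wh w B i ^ 2 := fun i => by
    unfold wh; split_ifs <;> ring
  have es : ∀ i, w i ^ 2 = wl w B i ^ 2 + wh w B i ^ 2 := fun i => by
    unfold wl wh; split_ifs <;> ring
  have ew : w = fun i => wl w B i + wh w B i := by
    funext i; unfold wl wh; split_ifs <;> ring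
  unfold Good at hG
  rw [← hB] at hG
  obtain ⟨g1, g2, g3, g4⟩ := hG
  have c2 : ∀ r, cnd w (fun i => wl w B i ^ 2) σ r =
      (∑ i, wl w B i ^ 3 - ∑ i ∈ range r, xs (wl w B) σ i ^ 3) /
        (∑ i, w i - ∑ i ∈ range r, xs w σ i) := by
    intro r
    unfold cnd
    simp only [e3, xs_pow (wl w B) _ _ 3 (by norm_num)]
  refine
  { C1 := H.C1, K1 := H.K1, δ0 := H.δ0, δ1 := H.δ1, δ2 := ?_, ε0 := H.ε0, ε1 := H.ε1,
    k1 := by exact_mod_cast hk, y0 := H.y0, nn0 := hn, lm := H.lm, mM := by omega, ℓlo := H.ℓlo,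
    σ2h0 := Finset.sum_nonneg fun i _ => sq_nonneg _,
    σ2l0 := Finset.sum_nonneg fun i _ => sq_nonneg _,
    σ2e := ?_, σ2C := H.s2, σ3l0 := Finset.sum_nonneg fun i _ => pow_nonneg (hwl0 i) 3,
    σ3lC := ?_,
    σ4l0 := Finset.sum_nonneg fun i _ => pow_nonneg (hwl0 i) 4,
    yN := H.yN, NM := H.NM, Mn := H.Mn, h2 := H.h2, h4 := H.h4,
    x0 := fun r => xs_nonneg (fun i => (hw i).le) _ _, xl0 := fun r => xs_nonneg hwl0 _ _,
    R := fun r hr => H.R σ r hr, d_eq := ?_,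
    dh0 := fun r hr => cnd_nonneg hw hwh0 σ r (by omega),
    dh1 := ?_, dC1 := ?_, hX := ?_, hQ := ?_, hCc := ?_, hW := ?_ }
  · have := H.δs
    have : 0 ≤ C ^ 3 * δ := by have := H.δ0; have := H.C1; positivity
    linarith
  · rw [← Finset.sum_add_distrib]; exact Finset.sum_congr rfl fun i _ => es i
  · refine le_trans (Finset.sum_le_sum fun i _ => ?_) H.s3
    exact pow_le_pow_left₀ (hwl0 i) (hwle i) 3
  · intro r hr
    have a1 : cnd w w σ r = cnd w (wl w B) σ r + cnd w (wh w B) σ r := by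
      rw [← cnd_add, ← ew]
    rw [a1]
    congr 1
    unfold cnd
    simp only [e2, xs_pow (wl w B) _ _ 2 (by norm_num)]
  · intro r hr
    have := cnd_le hw hwh0 σ r (by omega)
    simpa only [eh] using this
  · intro r hr
    have := cnd_le (g := fun i => wl w B i ^ 3) hw (fun i => pow_nonneg (hwl0 i) 3) σ r (by omega)
    simpa only [e4] using this
  · intro s hs
    have := g1 s hs
    rw [SS, Nat.Ico_zero_eq_range] at this
    refine this.trans (le_of_eq ?_)
    ring
  · intro s hs
    have := g2 s hs
    rw [SS, Nat.Ico_zero_eq_range] at this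
    simp only [xs_smul, cnd_smul, ← mul_sub, ← Finset.mul_sum, c2,
      xs_pow (wl w B) _ _ 2 two_ne_zero] at this
    rw [abs_mul, abs_of_pos (inv_pos.2 hB0), inv_mul_le_iff₀ hB0] at this
    refine this.trans (le_of_eq ?_)
    rw [hB]
    field_simp
  · intro s hs
    have := g3 s hs
    rw [SS, Nat.Ico_zero_eq_range] at this
    have hB2 : 0 < B ^ 2 := by positivity
    simp only [xs_smul, cnd_smul, ← mul_sub, ← Finset.mul_sum,
      xs_pow (wl w B) _ _ 3 three_ne_zero] at this
    rw [abs_mul, abs_of_pos (inv_pos.2 hB2), inv_mul_le_iff₀ hB2] at this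
    refine this.trans (le_of_eq ?_)
    rw [hB]
    field_simp
  · intro s hs hsm
    have := g4 s hs hsm
    rw [SS] at this
    refine this.trans (le_of_eq ?_)
    ring

end

end

end DPC

namespace DPC
open Finset

noncomputable section

lemma ind_nonneg (A : Prop) : 0 ≤ ind A := by unfold ind; split_ifs <;> norm_num
lemma ind_pos {A : Prop} (hA : A) : ind A = 1 := if_pos hA

section
variable {C K δ ε c0 y cn p : ℝ} {n : ℕ} {w : Fin n → ℝ} {l m h : ℕ}

/-- the exponent -/
def Lam (c0 y cn : ℝ) (l m : ℕ) : ℝ := c0 * y ^ 2 / (y * cn + ((m : ℝ) - l))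

lemma FH.Lam0 (H : FH C K δ ε c0 y cn p w l m h) : 0 < Lam c0 y cn l m := by
  have := H.c00; have := H.y0; have := H.cn0; have := H.Npos
  unfold Lam; positivity

lemma FH.Lam1 (H : FH C K δ ε c0 y cn p w l m h) : Lam c0 y cn l m * cn ≤ c0 * y := by
  have := H.c00; have := H.y0; have := H.cn0; have hN := H.Npos
  have hy := H.y0
  unfold Lam
  rw [div_mul_eq_mul_div, div_le_iff₀ (by positivity)]
  have : 0 ≤ c0 * y * ((m : ℝ) - l) := by positivity
  nlinarith

lemma FH.Lam2 (H : FH C K δ ε c0 y cn p w l m h) :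
    Lam c0 y cn l m * ((m : ℝ) - l) ≤ c0 * y ^ 2 := by
  have := H.c00; have := H.y0; have := H.cn0; have hN := H.Npos
  have hy := H.y0
  unfold Lam
  rw [div_mul_eq_mul_div, div_le_iff₀ (by positivity)]
  have : 0 ≤ c0 * y ^ 2 * (y * cn) := by positivity
  nlinarith

lemma FH.tail (H : FH C K δ ε c0 y cn p w l m h) (ψ : Fin n → ℝ) (hψ0 : ∀ i, 0 ≤ ψ i)
    (hψ : ∀ i, ψ i ≤ w i) (a b : ℕ) (hab : a ≤ b) (hb : b ≤ m + h) (τ : ℝ) (hτ : 1 ≤ τ)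
    (hτ2 : (b : ℝ) - a ≤ ((m : ℝ) - l) * τ ^ 2) (k : ℕ) (hk : 1 ≤ k) :
    EE w (fun σ => ind (∃ s, a ≤ s ∧ s ≤ b ∧ k * (ε * y * τ) < |SS w ψ a s σ|)) ≤
      2 * Real.exp (-Lam c0 y cn l m) ^ k := by
  have hC1 := H.C1
  have hn : (0 : ℝ) < n := by exact_mod_cast H.n0
  have hL := H.Lam0
  have hL1 := H.Lam1
  have hL2 := H.Lam2
  have hε := H.ε0
  have hy := H.y0
  have hN := H.Npos
  have hδ := H.δ0
  have hc0 := H.c00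
  generalize Lam c0 y cn l m = Λ at *
  have hk1 : (1 : ℝ) ≤ k := by exact_mod_cast hk
  have ht : 0 < ε * y * τ := by positivity
  have hV : ∀ σ : Equiv.Perm (Fin n), ∀ r, r < b → cnd w (fun k => ψ k ^ 2) σ r ≤ 2 * C ^ 2 := by
    intro σ r hr
    have hrn : r < n := by have := H.Mlen; omega
    have h1 : cnd w (fun k => ψ k ^ 2) σ r ≤ cnd w (fun k => w k ^ 2) σ r :=
      cnd_mono H.hw (fun i => pow_le_pow_left₀ (hψ0 i) (hψ i) 2) σ r hrn
    have h2 := cnd_le (g := fun k => w k ^ 2) H.hw (fun i => sq_nonneg _) σ r hrn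
    have h3 : ∑ i, w i * w i ^ 2 ≤ C * n := by
      refine le_trans (le_of_eq ?_) H.s3
      exact Finset.sum_congr rfl fun i _ => by ring
    have h4 := div_bd hn (by linarith : 0 < C) (H.R σ r (by omega)) h3 (by positivity)
    have h5 : 2 * C / n * (C * n) = 2 * C ^ 2 := by field_simp
    linarith
  have hθ0 : 0 < 2 * Λ / (ε * y * τ) := by positivity
  have hθ1 : ∀ i, |ψ i| * (2 * Λ / (ε * y * τ)) ≤ 1 := by
    intro i
    rw [abs_of_nonneg (hψ0 i), ← mul_div_assoc, div_le_one ht]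
    have h1 : ψ i ≤ δ * cn := (hψ i).trans (H.wmax i)
    calc ψ i * (2 * Λ) ≤ δ * cn * (2 * Λ) := by gcongr
      _ = 2 * δ * (Λ * cn) := by ring
      _ ≤ 2 * δ * (c0 * y) := by gcongr
      _ = (2 * c0 * δ) * y := by ring
      _ ≤ ε * y := by have := H.c02; gcongr
      _ ≤ ε * y * τ := le_mul_of_one_le_right (by positivity) hτ
  have hmax := maximal_abs H.hw ψ (2 * Λ / (ε * y * τ)) (2 * C ^ 2) (k * (ε * y * τ)) a b hab
    (hb.trans H.Mlen) hθ0 hθ1 (by positivity) hV (by positivity)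
  refine hmax.trans ?_
  rw [← Real.exp_nat_mul]
  gcongr
  have e1 : 2 * Λ / (ε * y * τ) * (k * (ε * y * τ)) = 2 * k * Λ := by field_simp
  have e2 : (2 * Λ / (ε * y * τ)) ^ 2 * ((b : ℝ) - a) * (2 * C ^ 2) ≤ Λ := by
    rw [div_pow, div_mul_eq_mul_div, div_mul_eq_mul_div, div_le_iff₀ (by positivity)]
    calc (2 * Λ) ^ 2 * ((b : ℝ) - a) * (2 * C ^ 2) ≤
        (2 * Λ) ^ 2 * (((m : ℝ) - l) * τ ^ 2) * (2 * C ^ 2) := by gcongr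
      _ = Λ * (8 * C ^ 2 * τ ^ 2 * (Λ * ((m : ℝ) - l))) := by ring
      _ ≤ Λ * (8 * C ^ 2 * τ ^ 2 * (c0 * y ^ 2)) := by gcongr
      _ = Λ * ((8 * C ^ 2 * c0) * (y * τ) ^ 2) := by ring
      _ ≤ Λ * (ε ^ 2 * (y * τ) ^ 2) := by have := H.c01; gcongr
      _ = _ := by ring
  rw [e1]
  nlinarith

lemma FH.good_tail (H : FH C K δ ε c0 y cn p w l m h) (k : ℕ) (hk : 1 ≤ k) :
    EE w (fun σ => ind (¬ Good w ε y l m h k σ)) ≤ 8 * Real.exp (-Lam c0 y cn l m) ^ k := by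
  have hM := H.Mpos
  have hN := H.Npos
  have hw := H.hw
  have hn : (0 : ℝ) < n := by exact_mod_cast H.n0
  set B : ℝ := n / ((m + h : ℕ) : ℝ) with hB
  have hB0 : 0 < B := by positivity
  set τ := ((m + h : ℕ) : ℝ) / ((m : ℝ) - l) with hτ
  have hmM : (m : ℝ) ≤ ((m + h : ℕ) : ℝ) := by exact_mod_cast (by omega)
  have hNM : (m : ℝ) - l ≤ ((m + h : ℕ) : ℝ) := by
    have : (0 : ℝ) ≤ l := by positivity
    linarith
  have hτ1 : 1 ≤ τ := by rw [hτ, le_div_iff₀ hN]; linarith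
  have hτ2 : ((m + h : ℕ) : ℝ) - (0 : ℕ) ≤ ((m : ℝ) - l) * τ ^ 2 := by
    have : ((m : ℝ) - l) * τ ^ 2 = ((m + h : ℕ) : ℝ) * τ := by rw [hτ]; field_simp
    rw [this, Nat.cast_zero, sub_zero]
    exact le_mul_of_one_le_right hM.le hτ1
  have hwl0 : ∀ i, 0 ≤ wl w B i := fun i => by unfold wl; split_ifs; exacts [(hw i).le, le_rfl]
  have t1 := H.tail w (fun i => (hw i).le) (fun i => le_rfl) 0 (m + h) (by omega) le_rfl τ hτ1 hτ2 k hk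
  have t2 := H.tail (fun i => B⁻¹ * wl w B i ^ 2)
    (fun i => mul_nonneg (inv_pos.2 hB0).le (sq_nonneg _)) (fun i => by
      rw [inv_mul_le_iff₀ hB0]
      unfold wl; have := hw i; split_ifs
      · nlinarith
      · simp; positivity) 0 (m + h) (by omega) le_rfl τ hτ1 hτ2 k hk
  have t3 := H.tail (fun i => (B ^ 2)⁻¹ * wl w B i ^ 3)
    (fun i => mul_nonneg (inv_pos.2 (by positivity)).le (pow_nonneg (hwl0 i) 3)) (fun i => by
      rw [inv_mul_le_iff₀ (by positivity)]
      unfold wl; have := hw i; split_ifs with hc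
      · calc w i ^ 3 = w i ^ 2 * w i := by ring
          _ ≤ B ^ 2 * w i := by gcongr
      · simp; positivity) 0 (m + h) (by omega) le_rfl τ hτ1 hτ2 k hk
  have t4 := H.tail w (fun i => (hw i).le) (fun i => le_rfl) l m H.lm.le (by omega) 1 le_rfl
    (by simp) k hk
  have hu : ∀ σ : Equiv.Perm (Fin n), ind (¬ Good w ε y l m h k σ) ≤
      (ind (∃ s, 0 ≤ s ∧ s ≤ m + h ∧ k * (ε * y * τ) < |SS w w 0 s σ|) +
       ind (∃ s, 0 ≤ s ∧ s ≤ m + h ∧ k * (ε * y * τ) <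
        |SS w (fun i => B⁻¹ * wl w B i ^ 2) 0 s σ|)) +
      (ind (∃ s, 0 ≤ s ∧ s ≤ m + h ∧ k * (ε * y * τ) <
        |SS w (fun i => (B ^ 2)⁻¹ * wl w B i ^ 3) 0 s σ|) +
      ind (∃ s, l ≤ s ∧ s ≤ m ∧ k * (ε * y * 1) < |SS w w l s σ|)) := by
    intro σ
    have n1 := ind_nonneg (∃ s, 0 ≤ s ∧ s ≤ m + h ∧ k * (ε * y * τ) < |SS w w 0 s σ|)
    have n2 := ind_nonneg (∃ s, 0 ≤ s ∧ s ≤ m + h ∧ k * (ε * y * τ) <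
        |SS w (fun i => B⁻¹ * wl w B i ^ 2) 0 s σ|)
    have n3 := ind_nonneg (∃ s, 0 ≤ s ∧ s ≤ m + h ∧ k * (ε * y * τ) <
        |SS w (fun i => (B ^ 2)⁻¹ * wl w B i ^ 3) 0 s σ|)
    have n4 := ind_nonneg (∃ s, l ≤ s ∧ s ≤ m ∧ k * (ε * y * 1) < |SS w w l s σ|)
    by_cases hg : Good w ε y l m h k σ
    · rw [ind, if_neg (not_not.2 hg)]; positivity
    · rw [ind_pos hg]
      unfold Good at hg
      rw [← hB, ← hτ] at hg
      rw [not_and_or, not_and_or, not_and_or] at hg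
      rcases hg with hg | hg | hg | hg
      · push Not at hg
        obtain ⟨s, hs, hs'⟩ := hg
        rw [ind_pos ⟨s, Nat.zero_le _, hs, hs'⟩]; linarith
      · push Not at hg
        obtain ⟨s, hs, hs'⟩ := hg
        rw [ind_pos (A := ∃ s, 0 ≤ s ∧ s ≤ m + h ∧ k * (ε * y * τ) <
          |SS w (fun i => B⁻¹ * wl w B i ^ 2) 0 s σ|) ⟨s, Nat.zero_le _, hs, hs'⟩]; linarith
      · push Not at hg
        obtain ⟨s, hs, hs'⟩ := hg
        rw [ind_pos (A := ∃ s, 0 ≤ s ∧ s ≤ m + h ∧ k * (ε * y * τ) <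
          |SS w (fun i => (B ^ 2)⁻¹ * wl w B i ^ 3) 0 s σ|) ⟨s, Nat.zero_le _, hs, hs'⟩]; linarith
      · push Not at hg
        obtain ⟨s, hs0, hs, hs'⟩ := hg
        rw [ind_pos (A := ∃ s, l ≤ s ∧ s ≤ m ∧ k * (ε * y * 1) < |SS w w l s σ|)
          ⟨s, hs0, hs, hs'⟩]; linarith
  have := EE_mono hw (F := fun σ => ind (¬ Good w ε y l m h k σ)) (G := fun σ =>
      (ind (∃ s, 0 ≤ s ∧ s ≤ m + h ∧ k * (ε * y * τ) < |SS w w 0 s σ|) +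
       ind (∃ s, 0 ≤ s ∧ s ≤ m + h ∧ k * (ε * y * τ) <
        |SS w (fun i => B⁻¹ * wl w B i ^ 2) 0 s σ|)) +
      (ind (∃ s, 0 ≤ s ∧ s ≤ m + h ∧ k * (ε * y * τ) <
        |SS w (fun i => (B ^ 2)⁻¹ * wl w B i ^ 3) 0 s σ|) +
      ind (∃ s, l ≤ s ∧ s ≤ m ∧ k * (ε * y * 1) < |SS w w l s σ|))) hu
  rw [EE_add, EE_add, EE_add] at this
  linarith

lemma FH.good_ex (H : FH C K δ ε c0 y cn p w l m h) (σ : Fin n → Fin n) :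
    ∃ k : ℕ, 1 ≤ k ∧ Good w ε y l m h k σ := by
  have hM := H.Mpos
  have hN := H.Npos
  have hε := H.ε0
  have hy := H.y0
  have bd : ∀ (F : ℕ → ℝ) (L : ℕ) (t : ℝ), 0 < t → ∃ k : ℕ, ∀ k', k ≤ k' →
      ∀ s, s ≤ L → |F s| ≤ (k' : ℝ) * t := by
    intro F L t ht
    obtain ⟨k, hk⟩ := exists_nat_ge ((∑ s ∈ range (L + 1), |F s|) / t)
    refine ⟨k, fun k' hk' s hs => ?_⟩
    rw [div_le_iff₀ ht] at hk
    have h1 : |F s| ≤ ∑ s ∈ range (L + 1), |F s| :=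
      Finset.single_le_sum (f := fun s => |F s|) (fun i _ => abs_nonneg _)
        (mem_range.2 (by omega))
    have : (k : ℝ) ≤ k' := by exact_mod_cast hk'
    have : (k : ℝ) * t ≤ k' * t := by gcongr
    linarith
  have ht1 : 0 < ε * y * (((m + h : ℕ) : ℝ) / ((m : ℝ) - l)) := by positivity
  obtain ⟨k1, h1⟩ := bd (fun s => SS w w 0 s σ) (m + h) _ ht1
  obtain ⟨k2, h2⟩ := bd (fun s => SS w (fun i => (n / ((m + h : ℕ) : ℝ))⁻¹ *
    wl w (n / ((m + h : ℕ) : ℝ)) i ^ 2) 0 s σ) (m + h) _ ht1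
  obtain ⟨k3, h3⟩ := bd (fun s => SS w (fun i => ((n / ((m + h : ℕ) : ℝ)) ^ 2)⁻¹ *
    wl w (n / ((m + h : ℕ) : ℝ)) i ^ 3) 0 s σ) (m + h) _ ht1
  obtain ⟨k4, h4⟩ := bd (fun s => SS w w l s σ) m (ε * y * 1) (by positivity)
  refine ⟨k1 + k2 + k3 + k4 + 1, by omega, h1 _ (by omega), h2 _ (by omega), h3 _ (by omega),
    fun s _ hs => h4 _ (by omega) s hs⟩

lemma sq_le_four_pow (j : ℕ) (hj : 1 ≤ j) : ((j : ℝ) + 1) ^ 2 ≤ 4 ^ j := by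
  induction j, hj using Nat.le_induction with
  | base => norm_num
  | succ j hj ih =>
    have e : (4 : ℝ) ^ (j + 1) = 4 ^ j * 4 := pow_succ _ _
    rw [e]
    push_cast
    have : (1 : ℝ) ≤ j := by exact_mod_cast hj
    nlinarith

lemma expect_bound (hw : ∀ i, 0 < w i) (P : ℕ → (Fin n → Fin n) → Prop) {q y : ℝ} (hq0 : 0 ≤ q)
    (hq : q ≤ 1 / 64) (hy : 0 < y)
    (hP : ∀ k, 1 ≤ k → EE w (fun σ => ind (¬ P k σ)) ≤ 8 * q ^ k)
    (hex : ∀ σ : Equiv.Perm (Fin n), ∃ k, 1 ≤ k ∧ P k σ) (F : (Fin n → Fin n) → ℝ) (c : ℝ)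
    (hF : ∀ σ : Equiv.Perm (Fin n), ∀ k : ℕ, 1 ≤ k → P k σ → |F σ - c| ≤ (k : ℝ) ^ 2 * y / 8) :
    |EE w F - c| ≤ y / 4 := by
  choose κ hκ1 hκ using hex
  set L := ∑ σ : Equiv.Perm (Fin n), κ σ with hL
  set U : (Fin n → Fin n) → ℝ := fun σ => y / 8 + y / 8 *
    ∑ j ∈ Icc 1 L, ((j : ℝ) + 1) ^ 2 * ind (¬ P j σ) with hU
  have hb : ∀ σ : Equiv.Perm (Fin n), |F σ - c| ≤ U σ := by
    intro σ
    have hex : ∃ k, 1 ≤ k ∧ P k σ := ⟨_, hκ1 σ, hκ σ⟩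
    obtain ⟨h1, h2⟩ := Nat.find_spec hex
    have hmin := fun {k} hk => Nat.find_min hex (m := k) hk
    have hle : Nat.find hex ≤ κ σ := Nat.find_min' hex ⟨hκ1 σ, hκ σ⟩
    have hle2 : κ σ ≤ L := Finset.single_le_sum (f := κ) (fun i _ => Nat.zero_le _) (mem_univ σ)
    generalize Nat.find hex = k at *
    have hFk := hF σ k h1 h2
    have hs0 : ∀ j ∈ Icc 1 L, 0 ≤ ((j : ℝ) + 1) ^ 2 * ind (¬ P j σ) :=
      fun j _ => mul_nonneg (sq_nonneg _) (ind_nonneg _)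
    have hs1 : 0 ≤ ∑ j ∈ Icc 1 L, ((j : ℝ) + 1) ^ 2 * ind (¬ P j σ) := Finset.sum_nonneg hs0
    refine hFk.trans ?_
    rw [hU]
    dsimp only
    rcases Nat.lt_or_ge 1 k with hk | hk
    · have hn : ¬ P (k - 1) σ := fun hp => hmin (k := k - 1) (by omega) ⟨by omega, hp⟩
      have h3 := Finset.single_le_sum hs0 (mem_Icc.2 ⟨by omega, by omega⟩ : k - 1 ∈ Icc 1 L)
      rw [ind_pos hn, Nat.cast_sub h1] at h3
      simp at h3
      nlinarith
    · have : k = 1 := by omega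
      subst this
      have : 0 ≤ y / 8 * ∑ j ∈ Icc 1 L, ((j : ℝ) + 1) ^ 2 * ind (¬ P j σ) := by positivity
      simp; linarith
  have hEU : EE w U ≤ y / 4 := by
    rw [hU, EE_add, EE_smul, EE_one hw, EE_sum]
    have h1 : ∑ j ∈ Icc 1 L, EE w (fun σ => ((j : ℝ) + 1) ^ 2 * ind (¬ P j σ)) ≤ 1 := by
      have h2 : ∀ j ∈ Icc 1 L, EE w (fun σ => ((j : ℝ) + 1) ^ 2 * ind (¬ P j σ)) ≤
          8 * (1 / 16) ^ j := by
        intro j hj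
        have hj := (mem_Icc.1 hj).1
        rw [EE_smul]
        calc ((j : ℝ) + 1) ^ 2 * EE w (fun σ => ind (¬ P j σ)) ≤ 4 ^ j * (8 * q ^ j) := by
              have e0 := hP j hj
              calc _ ≤ ((j : ℝ) + 1) ^ 2 * (8 * q ^ j) := by gcongr
                _ ≤ _ := by have := sq_le_four_pow j hj; gcongr
          _ ≤ 4 ^ j * (8 * (1 / 64) ^ j) := by gcongr
          _ = 8 * (1 / 16) ^ j := by
              rw [show (1 / 16 : ℝ) = 4 * (1 / 64) by norm_num, mul_pow]; ring
      refine (Finset.sum_le_sum h2).trans ?_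
      have h3 : ∀ L : ℕ, ∑ j ∈ Icc 1 L, (8 : ℝ) * (1 / 16) ^ j ≤ 1 - (1 / 16) ^ L := by
        intro L
        induction L with
        | zero => simp
        | succ L ih =>
          rw [Finset.sum_Icc_succ_top (by omega), pow_succ]
          have : (0 : ℝ) ≤ (1 / 16) ^ L := by positivity
          linarith
      have : (0 : ℝ) ≤ (1 / 16) ^ L := by positivity
      linarith [h3 L]
    nlinarith
  have hc : EE w F - c = EE w (fun σ => F σ + (-c)) := by
    rw [EE_add, EE_one hw]; ring
  rw [hc, abs_le]
  constructor
  · have := EE_mono hw (F := fun σ => (-1) * U σ) (G := fun σ => F σ + (-c)) (fun σ => by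
      have := (abs_le.1 (hb σ)).1; linarith)
    rw [EE_smul] at this
    linarith
  · have := EE_mono hw (F := fun σ => F σ + (-c)) (G := U) (fun σ => by
      have := (abs_le.1 (hb σ)).2; linarith)
    linarith

end

end

end DPC

namespace DPC
open Finset

noncomputable section

lemma sb_integral {n : ℕ} {w : Fin n → ℝ} (hw : ∀ i, 0 < w i) (F : (Fin n → Fin n) → ℝ) :
    ∫ ω, F ω ∂sbMeasure n w = EE w F := by
  unfold sbMeasure
  rw [Measure.sum_fintype, integral_finsetSum_measure]
  · unfold EE
    refine Finset.sum_congr rfl fun σ _ => ?_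
    rw [integral_smul_measure, integral_dirac, smul_eq_mul, ENNReal.toReal_ofReal]
    · rfl
    · exact PP_nonneg hw σ
  · intro σ _
    refine Integrable.smul_measure ?_ ENNReal.ofReal_ne_top
    exact Integrable.of_finite

lemma sb_measure {n : ℕ} {w : Fin n → ℝ} (hw : ∀ i, 0 < w i) (A : (Fin n → Fin n) → Prop) :
    sbMeasure n w {ω | A ω} = ENNReal.ofReal (EE w (fun ω => ind (A ω))) := by
  unfold sbMeasure
  rw [Measure.sum_fintype, Measure.finsetSum_apply, EE, ENNReal.ofReal_sum_of_nonneg]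
  · refine Finset.sum_congr rfl fun σ _ => ?_
    rw [Measure.smul_apply, Measure.dirac_apply' _ (Set.toFinite _).measurableSet, smul_eq_mul,
      ENNReal.ofReal_mul (PP_nonneg hw σ)]
    congr 1
    unfold ind
    by_cases h : A σ <;> simp [h]
  · intro σ _
    have : 0 ≤ ind (A σ) := ind_nonneg _
    exact mul_nonneg (PP_nonneg hw σ) this

/-- the increments of `Ltilde` -/
def GG {n : ℕ} (w : Fin n → ℝ) (p : ℝ) (σ : Fin n → Fin n) (h r : ℕ) : ℝ :=
    if hi : r < n then
      ∑ k : Fin n, if r + h < (k : ℕ) then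
        1 - Real.exp (-(w (σ ⟨r, hi⟩) * w (σ k) * p)) else 0
    else 0

lemma Lt_diff {n : ℕ} (w : Fin n → ℝ) (p : ℝ) (σ : Fin n → Fin n) (h i j : ℕ) (hij : i ≤ j) :
    Ltilde w p σ h j - Ltilde w p σ h i = ∑ r ∈ Ico i j, GG w p σ h r - ((j : ℝ) - i) := by
  unfold Ltilde
  rw [Finset.sum_Ico_eq_sub _ hij]
  unfold GG
  ring

lemma exp_lo (u : ℝ) (hu : 0 ≤ u) : u - u ^ 2 ≤ 1 - Real.exp (-u) := by
  have h1 : Real.exp (-u) * (1 + u) ≤ 1 := by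
    have := Real.add_one_le_exp u
    calc Real.exp (-u) * (1 + u) ≤ Real.exp (-u) * Real.exp u := by gcongr; linarith
      _ = 1 := by rw [← Real.exp_add]; simp
  have h0 := Real.exp_pos (-u)
  have h2 : Real.exp (-u) ≤ 1 / (1 + u) := by rw [le_div_iff₀ (by positivity)]; exact h1
  have h3 : 1 / (1 + u) ≤ 1 - u + u ^ 2 := by
    rw [div_le_iff₀ (by positivity)]
    have : 0 ≤ u ^ 3 := by positivity
    nlinarith
  linarith

lemma GG_eq {n : ℕ} (w : Fin n → ℝ) (p : ℝ) (σ : Fin n → Fin n) (h r : ℕ) (hr : r < n) :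
    GG w p σ h r = ∑ k ∈ univ.filter (fun k : Fin n => r + h + 1 ≤ (k : ℕ)),
      (1 - Real.exp (-(xs w σ r * w (σ k) * p))) := by
  unfold GG xs
  rw [dif_pos hr, dif_pos hr, Finset.sum_filter]
  rfl

lemma GG_up {n : ℕ} {w : Fin n → ℝ} {p : ℝ} (σ : Equiv.Perm (Fin n))
    (h r : ℕ) (hr : r + h + 1 ≤ n) :
    GG w p σ h r ≤ p * xs w σ r * ((∑ k, w k) - ∑ i ∈ range (r + h + 1), xs w σ i) := by
  rw [GG_eq _ _ _ _ _ (by omega), total_sub w σ _ hr, Finset.mul_sum]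
  refine Finset.sum_le_sum fun k _ => ?_
  have := Real.add_one_le_exp (-(xs w σ r * w (σ k) * p))
  linarith

lemma GG_lo {n : ℕ} {w : Fin n → ℝ} (hw : ∀ i, 0 < w i) {p : ℝ} (hp : 0 ≤ p)
    (σ : Equiv.Perm (Fin n)) (h r : ℕ) (hr : r + h + 1 ≤ n) :
    p * xs w σ r * ((∑ k, w k) - ∑ i ∈ range (r + h + 1), xs w σ i) -
      p ^ 2 * xs w σ r ^ 2 * ∑ k, w k ^ 2 ≤ GG w p σ h r := by
  rw [GG_eq _ _ _ _ _ (by omega), total_sub w σ _ hr, Finset.mul_sum]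
  have h0 : 0 ≤ xs w σ r := xs_nonneg (fun k => (hw k).le) _ _
  have h1 : ∑ k ∈ univ.filter (fun k : Fin n => r + h + 1 ≤ (k : ℕ)), w (σ k) ^ 2 ≤ ∑ k, w k ^ 2 := by
    rw [← Equiv.sum_comp σ (fun k => w k ^ 2)]
    exact Finset.sum_le_sum_of_subset_of_nonneg (Finset.filter_subset _ _) fun k _ _ => sq_nonneg _
  have h2 : ∑ k ∈ univ.filter (fun k : Fin n => r + h + 1 ≤ (k : ℕ)),
      (p * xs w σ r * w (σ k) - p ^ 2 * xs w σ r ^ 2 * w (σ k) ^ 2) ≤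
      ∑ k ∈ univ.filter (fun k : Fin n => r + h + 1 ≤ (k : ℕ)),
      (1 - Real.exp (-(xs w σ r * w (σ k) * p))) := by
    refine Finset.sum_le_sum fun k _ => ?_
    have := exp_lo (xs w σ r * w (σ k) * p) (by have := (hw (σ k)).le; positivity)
    refine le_trans (le_of_eq ?_) this
    ring
  rw [Finset.sum_sub_distrib, ← Finset.mul_sum] at h2
  have h3 : p ^ 2 * xs w σ r ^ 2 * ∑ k ∈ univ.filter (fun k : Fin n => r + h + 1 ≤ (k : ℕ)), w (σ k) ^ 2
      ≤ p ^ 2 * xs w σ r ^ 2 * ∑ k, w k ^ 2 := by gcongr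
  rw [← Finset.mul_sum] at h2 ⊢
  linarith

section
variable {C K δ ε c0 y cn p : ℝ} {n : ℕ} {w : Fin n → ℝ} {l m h : ℕ}

lemma FH.near (H : FH C K δ ε c0 y cn p w l m h) (i j : ℕ) (hi : l ≤ i) (hij : i ≤ j)
    (hj : j ≤ m) : ∃ c : ℝ, ∀ σ : Equiv.Perm (Fin n), ∀ k : ℕ, 1 ≤ k → Good w ε y l m h k σ →
      |Ltilde w p σ h j - Ltilde w p σ h i - c| ≤ (k : ℝ) ^ 2 * y / 8 := by
  refine ⟨∑ r ∈ Ico i j, beta p (∑ i, w i) (∑ i, w i ^ 2) h r *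
    cc (∑ i, wl w (n / ((m + h : ℕ) : ℝ)) i ^ 2) (∑ i, wl w (n / ((m + h : ℕ) : ℝ)) i ^ 3)
      (∑ i, w i ^ 2) (∑ i, w i) r - ((j : ℝ) - i), fun σ k hk hG => ?_⟩
  have D := H.dh σ k hk hG
  have hδ := H.δ0
  have hcn := H.cn0
  have hMn := H.Mlen
  have := D.det (h := h) (p := p) (cn := cn) (G := GG w p σ h) rfl H.p0 H.pl H.cn0.le H.cny
    (fun r => by
      unfold xs; split_ifs
      · exact H.wmax _
      · positivity)
    (fun r hr => GG_up σ h r (by omega)) (fun r hr => GG_lo H.hw H.p0 σ h r (by omega))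
    H.δ3 H.δ4 H.δ5 i j hi hij hj
  rw [Lt_diff _ _ _ _ _ _ hij, sub_sub_sub_cancel_right]
  refine this.trans ?_
  have hy := H.y0
  have h1 := H.εC
  have : 0 ≤ (k : ℝ) ^ 2 * y := by positivity
  nlinarith

lemma FH.main (H : FH C K δ ε c0 y cn p w l m h) :
    sbMeasure n w {ω : Fin n → Fin n | ∃ i j : ℕ, l ≤ i ∧ i ≤ j ∧ j ≤ m ∧
            y ≤ |Ltilde w p ω h j - Ltilde w p ω h i -
                ∫ ω', (Ltilde w p ω' h j - Ltilde w p ω' h i) ∂sbMeasure n w|} ≤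
      ENNReal.ofReal (8 * Real.exp (-Lam c0 y cn l m)) := by
  have hy := H.y0
  rw [sb_measure H.hw]
  apply ENNReal.ofReal_le_ofReal
  have h1 := H.good_tail 1 le_rfl
  rw [pow_one] at h1
  refine le_trans (EE_mono H.hw fun σ => ?_) h1
  by_cases hg : Good w ε y l m h 1 σ
  · have : ¬ ∃ i j : ℕ, l ≤ i ∧ i ≤ j ∧ j ≤ m ∧
            y ≤ |Ltilde w p σ h j - Ltilde w p σ h i -
                ∫ ω', (Ltilde w p ω' h j - Ltilde w p ω' h i) ∂sbMeasure n w| := by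
      rintro ⟨i, j, hi, hij, hj, hb⟩
      rw [sb_integral H.hw] at hb
      obtain ⟨c, hc⟩ := H.near i j hi hij hj
      have e1 := hc σ 1 le_rfl hg
      have e2 := expect_bound H.hw (Good w ε y l m h) (Real.exp_pos (-Lam c0 y cn l m)).le
        (by
          rw [Real.exp_neg, one_div]
          exact inv_anti₀ (by norm_num) H.Λ64) hy H.good_tail (fun σ => H.good_ex σ)
        (fun ω' => Ltilde w p ω' h j - Ltilde w p ω' h i) c hc
      generalize EE w (fun ω' => Ltilde w p ω' h j - Ltilde w p ω' h i) = E at *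
      generalize Ltilde w p σ h j - Ltilde w p σ h i = Z at *
      have e3 := abs_sub_le Z c E
      rw [abs_sub_comm c E] at e3
      simp at e1
      linarith
    rw [ind, if_neg this]
    exact ind_nonneg _
  · rw [ind_pos hg]
    unfold ind; split_ifs <;> norm_num

end

end

end DPC

namespace DPC
open Finset

noncomputable section

lemma tend_of_littleO {S : ℕ → ℝ} {e : ℝ}
    (h : (fun n : ℕ => S n - e * (n : ℝ)) =o[atTop] fun n : ℕ => (n : ℝ)) :
    Tendsto (fun n : ℕ => S n / (n : ℝ)) atTop (𝓝 e) := by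
  have h1 := h.tendsto_div_nhds_zero
  have h2 : Tendsto (fun n : ℕ => (S n - e * (n : ℝ)) / n + e) atTop (𝓝 (0 + e)) :=
    h1.add_const e
  rw [zero_add] at h2
  refine h2.congr' ?_
  filter_upwards [eventually_gt_atTop 0] with n hn
  have : (0 : ℝ) < n := by exact_mod_cast hn
  field_simp
  ring

lemma rpow_bigO {a : ℝ} (ha : a ≤ 1) :
    (fun n : ℕ => (n : ℝ) ^ a) =O[atTop] fun n : ℕ => (n : ℝ) := by
  refine IsBigO.of_bound 1 ?_
  filter_upwards [eventually_ge_atTop 1] with n hn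
  have h1 : (1 : ℝ) ≤ n := by exact_mod_cast hn
  rw [one_mul, Real.norm_of_nonneg (by positivity), Real.norm_of_nonneg (by positivity)]
  calc (n : ℝ) ^ a ≤ (n : ℝ) ^ (1 : ℝ) := Real.rpow_le_rpow_of_exponent_le h1 ha
    _ = n := Real.rpow_one _

lemma one_bigO : (fun _ : ℕ => (1 : ℝ)) =O[atTop] fun n : ℕ => (n : ℝ) := by
  simpa using rpow_bigO (a := 0) (by norm_num)

lemma ev_le {S : ℕ → ℝ} {e c : ℝ} (h : Tendsto (fun n : ℕ => S n / (n : ℝ)) atTop (𝓝 e))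
    (hc : e < c) : ∀ᶠ n : ℕ in atTop, S n ≤ c * n := by
  filter_upwards [h.eventually_lt_const hc, eventually_gt_atTop 0] with n hn hn0
  have : (0 : ℝ) < n := by exact_mod_cast hn0
  rw [div_lt_iff₀ this] at hn
  exact hn.le

lemma ev_ge {S : ℕ → ℝ} {e c : ℝ} (h : Tendsto (fun n : ℕ => S n / (n : ℝ)) atTop (𝓝 e))
    (hc : c < e) : ∀ᶠ n : ℕ in atTop, c * n ≤ S n := by
  filter_upwards [h.eventually_const_lt hc, eventually_gt_atTop 0] with n hn hn0
  have : (0 : ℝ) < n := by exact_mod_cast hn0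
  rw [lt_div_iff₀ this] at hn
  exact hn.le

section
variable {w : ∀ n : ℕ, Fin n → ℝ} {μ : Measure ℝ}

lemma e1_pos (hC : CondC w μ) : 0 < ∫ x, x ∂μ := by
  have := hC.isProb
  have hInt1 : Integrable (fun x : ℝ => x) μ := by
    refine Integrable.mono' ((integrable_const (1 : ℝ)).add hC.int3.norm)
      measurable_id.aestronglyMeasurable (Eventually.of_forall fun x => ?_)
    simp only [Pi.add_apply, Real.norm_eq_abs, abs_pow]
    rcases le_total |x| 1 with h | h
    · have : 0 ≤ |x| ^ 3 := by positivity
      linarith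
    · have : |x| ≤ |x| ^ 3 := le_self_pow₀ h (by norm_num)
      linarith
  have hnn : 0 ≤ᵐ[μ] fun x : ℝ => x := hC.pos.mono fun x hx => hx.le
  refine lt_of_le_of_ne (integral_nonneg_of_ae hnn) fun h0 => ?_
  have h1 := (integral_eq_zero_iff_of_nonneg_ae hnn hInt1).1 h0.symm
  have h2 : ∀ᵐ x ∂μ, False := by
    filter_upwards [h1, hC.pos] with x hx hx'
    simp at hx
    linarith
  simp at h2
  exact IsProbabilityMeasure.ne_zero μ h2

lemma t1 (hC : CondC w μ) : Tendsto (fun n : ℕ => (∑ i, w n i) / (n : ℝ)) atTop (𝓝 (∫ x, x ∂μ)) :=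
  tend_of_littleO (S := fun n => ∑ i, w n i) (hC.ell_asymp.trans_isBigO (rpow_bigO (by norm_num)))

lemma t2 (hC : CondC w μ) :
    Tendsto (fun n : ℕ => (∑ i, w n i ^ 2) / (n : ℝ)) atTop (𝓝 (∫ x, x ^ 2 ∂μ)) :=
  tend_of_littleO (S := fun n => ∑ i, w n i ^ 2)
    (hC.sq_asymp.trans_isBigO (rpow_bigO (by norm_num)))

lemma t3 (hC : CondC w μ) :
    Tendsto (fun n : ℕ => (∑ i, w n i ^ 3) / (n : ℝ)) atTop (𝓝 (∫ x, x ^ 3 ∂μ)) :=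
  tend_of_littleO (S := fun n => ∑ i, w n i ^ 3) (hC.cube_asymp.trans_isBigO one_bigO)

/-- truncated cube -/
def gB (B : ℝ) (hB : 0 ≤ B) : BoundedContinuousFunction ℝ ℝ :=
  BoundedContinuousFunction.ofNormedAddCommGroup (fun x => (min (max x 0) B) ^ 3)
    (by fun_prop) (B ^ 3) (fun x => by
      have h0 : 0 ≤ min (max x 0) B := le_min (le_max_right _ _) hB
      rw [Real.norm_of_nonneg (by positivity)]
      exact pow_le_pow_left₀ h0 (min_le_right _ _) 3)

lemma gB_apply (B : ℝ) (hB : 0 ≤ B) (x : ℝ) : gB B hB x = (min (max x 0) B) ^ 3 := rfl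

lemma ui (hC : CondC w μ) {δ : ℝ} (hδ : 0 < δ) : ∃ B0 : ℝ, 0 < B0 ∧ ∀ᶠ n : ℕ in atTop,
    ∑ i, (if w n i ≤ B0 then 0 else w n i ^ 3) ≤ δ * n := by
  have := hC.isProb
  have hlim : Tendsto (fun N : ℕ => ∫ x, gB N (Nat.cast_nonneg N) x ∂μ) atTop
      (𝓝 (∫ x, x ^ 3 ∂μ)) := by
    refine tendsto_integral_of_dominated_convergence (fun x => |x ^ 3|) (fun N => ?_)
      hC.int3.abs (fun N => ?_) ?_
    · exact (gB N (Nat.cast_nonneg N)).continuous.aestronglyMeasurable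
    · refine hC.pos.mono fun x hx => ?_
      have h0 : (0 : ℝ) ≤ min (max x 0) N := le_min (le_max_right _ _) (Nat.cast_nonneg N)
      rw [gB_apply, Real.norm_of_nonneg (by positivity), abs_of_nonneg (by positivity)]
      refine pow_le_pow_left₀ h0 ?_ 3
      exact (min_le_left _ _).trans (max_le le_rfl hx.le)
    · refine hC.pos.mono fun x hx => ?_
      obtain ⟨N0, hN0⟩ := exists_nat_ge x
      refine tendsto_const_nhds.congr' ?_
      filter_upwards [eventually_ge_atTop N0] with N hN
      have : x ≤ N := hN0.trans (by exact_mod_cast hN)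
      rw [gB_apply, max_eq_left hx.le, min_eq_left this]
  obtain ⟨N, hN, hN1⟩ := ((hlim.eventually_const_lt
    (show (∫ x, x ^ 3 ∂μ) - δ / 4 < ∫ x, x ^ 3 ∂μ by linarith)).and
      (eventually_ge_atTop 1)).exists
  have hNp : (1 : ℝ) ≤ N := by exact_mod_cast hN1
  refine ⟨2 * N, by linarith, ?_⟩
  have hT := (t3 hC).sub (hC.weak (gB N (Nat.cast_nonneg N)))
  have hT' : Tendsto (fun n : ℕ => (∑ i, (w n i ^ 3 - gB N (Nat.cast_nonneg N) (w n i))) / (n : ℝ))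
      atTop (𝓝 (∫ x, x ^ 3 ∂μ - ∫ x, gB N (Nat.cast_nonneg N) x ∂μ)) := by
    refine hT.congr fun n => ?_
    rw [Finset.sum_sub_distrib, sub_div]
  filter_upwards [ev_le hT' (show _ < δ / 2 by linarith)] with n hn
  have h1 : ∑ i, (if w n i ≤ 2 * N then 0 else w n i ^ 3) ≤
      ∑ i, 2 * (w n i ^ 3 - gB N (Nat.cast_nonneg N) (w n i)) := by
    refine Finset.sum_le_sum fun i _ => ?_
    have hwi := hC.w_pos n i
    rw [gB_apply, max_eq_left hwi.le]
    split_ifs with hc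
    · have : (min (w n i) N) ^ 3 ≤ w n i ^ 3 :=
        pow_le_pow_left₀ (le_min hwi.le (Nat.cast_nonneg N)) (min_le_left _ _) 3
      linarith
    · push Not at hc
      rw [min_eq_right (by linarith)]
      have : (2 * (N : ℝ)) ^ 3 ≤ w n i ^ 3 := pow_le_pow_left₀ (by positivity) hc.le 3
      have h8 : (2 * (N : ℝ)) ^ 3 = 8 * (N : ℝ) ^ 3 := by ring
      have h9 : 0 ≤ (N : ℝ) ^ 3 := by positivity
      linarith
  rw [← Finset.mul_sum] at h1
  linarith

lemma pf_bd {w : ∀ n : ℕ, Fin n → ℝ} {f : ℕ → ℝ} {n : ℕ} (hl : 0 < ell w n)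
    (hf : |f n| ≤ ell w n ^ ((1 : ℝ) / 3)) : 0 ≤ pf w f n ∧ pf w f n * ∑ k, w n k ≤ 2 := by
  have h3 : 0 < ell w n ^ ((1 : ℝ) / 3) := Real.rpow_pos_of_pos hl _
  have h4 : ell w n ^ ((4 : ℝ) / 3) = ell w n ^ ((1 : ℝ) / 3) * ell w n := by
    rw [← Real.rpow_add_one hl.ne']; norm_num
  have hf' := abs_le.1 hf
  unfold pf
  refine ⟨div_nonneg (by linarith) (Real.rpow_pos_of_pos hl _).le, ?_⟩
  change _ * ell w n ≤ 2
  rw [h4]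
  have : (ell w n ^ ((1 : ℝ) / 3) + f n) / (ell w n ^ ((1 : ℝ) / 3) * ell w n) * ell w n =
    (ell w n ^ ((1 : ℝ) / 3) + f n) / ell w n ^ ((1 : ℝ) / 3) := by field_simp
  rw [this, div_le_iff₀ h3]
  linarith

lemma heavy {n : ℕ} {w : Fin n → ℝ} (hw : ∀ i, 0 < w i) {B0 M δ : ℝ} (hM : 0 < M)
    (hn : (0 : ℝ) < n) (hB : M * B0 ≤ n)
    (hui : ∑ i, (if w i ≤ B0 then 0 else w i ^ 3) ≤ δ * n) : ∑ k, wh w (n / M) k ^ 2 ≤ δ * M := by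
  have h1 : ∀ i, wh w (n / M) i ^ 2 ≤ M / n * (if w i ≤ B0 then 0 else w i ^ 3) := by
    intro i
    have hwi := hw i
    unfold wh
    split_ifs with a b b
    · simp
    · simp; positivity
    · exfalso
      apply a
      refine b.trans ?_
      rw [le_div_iff₀ hM]; linarith
    · push Not at a
      rw [div_lt_iff₀ hM] at a
      rw [div_mul_eq_mul_div, le_div_iff₀ hn]
      have : 0 ≤ w i ^ 2 := by positivity
      nlinarith
  refine (Finset.sum_le_sum fun i _ => h1 i).trans ?_
  rw [← Finset.mul_sum]
  calc _ ≤ M / n * (δ * n) := by gcongr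
    _ = δ * M := by field_simp

lemma light {n : ℕ} {w : Fin n → ℝ} (hw : ∀ i, 0 < w i) {B0 M δ C : ℝ} (hM : 0 < M)
    (hn : (0 : ℝ) < n) (hB0 : 0 < B0) (hMd : M * (B0 * C) ≤ δ / 2 * n)
    (h3 : ∑ i, w i ^ 3 ≤ C * n)
    (hui : ∑ i, (if w i ≤ B0 then 0 else w i ^ 3) ≤ δ / 2 * n) :
    M * ∑ k, wl w (n / M) k ^ 4 ≤ δ * (n : ℝ) ^ 2 := by
  have h1 : ∀ i, wl w (n / M) i ^ 4 ≤ B0 * w i ^ 3 +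
      n / M * (if w i ≤ B0 then 0 else w i ^ 3) := by
    intro i
    have hwi := hw i
    have h0 : 0 ≤ B0 * w i ^ 3 := by positivity
    have h3 : 0 ≤ w i ^ 3 := by positivity
    unfold wl
    split_ifs with a b b
    · have : w i ^ 4 = w i * w i ^ 3 := by ring
      rw [this, mul_zero, add_zero]
      gcongr
    · have : w i ^ 4 = w i * w i ^ 3 := by ring
      rw [this]
      have : w i * w i ^ 3 ≤ n / M * w i ^ 3 := by gcongr
      linarith
    · simp; positivity
    · have : 0 ≤ n / M * w i ^ 3 := by positivity
      simp; linarith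
  have h2 := Finset.sum_le_sum fun i (_ : i ∈ univ) => h1 i
  rw [Finset.sum_add_distrib, ← Finset.mul_sum, ← Finset.mul_sum] at h2
  calc M * ∑ k, wl w (n / M) k ^ 4 ≤ M * (B0 * (C * n) + n / M * (δ / 2 * n)) := by
        refine mul_le_mul_of_nonneg_left (h2.trans ?_) hM.le
        gcongr
    _ = M * (B0 * C) * n + δ / 2 * n * n := by field_simp
    _ ≤ δ / 2 * n * n + δ / 2 * n * n := by gcongr
    _ = _ := by ring

end

end

end DPC

namespace DPC

lemma lam_aux {c0 y cn N S : ℝ} (hc : 0 < c0) (hc1 : c0 ≤ 1) (hy : 0 < y) (hcn : 0 < cn)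
    (hN : 0 < N) (hNS : N ≤ S)
    (h : Real.exp (-y ^ 2 / (3 / c0 * (y * cn + S))) < 1 / 4) :
    cn ≤ y ∧ 64 ≤ Real.exp (c0 * y ^ 2 / (y * cn + N)) := by
  have hD : 0 < y * cn + S := by have := mul_pos hy hcn; linarith
  have hD' : 0 < y * cn + N := by have := mul_pos hy hcn; linarith
  obtain ⟨x, hx⟩ : ∃ x, x = c0 * y ^ 2 / (3 * (y * cn + S)) := ⟨_, rfl⟩
  have e1 : -y ^ 2 / (3 / c0 * (y * cn + S)) = -x := by
    rw [hx]; field_simp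
  rw [e1, Real.exp_neg] at h
  have hp := Real.exp_pos x
  have h4 : 4 < Real.exp x := by
    rw [inv_lt_comm₀ hp (by norm_num)] at h
    linarith
  have hx1 : 1 < x := by
    by_contra hcon
    push Not at hcon
    have := Real.exp_le_exp.2 hcon
    have := Real.exp_one_lt_d9
    linarith
  constructor
  · rw [hx, lt_div_iff₀ (by positivity)] at hx1
    by_contra hcon
    push Not at hcon
    have : c0 * y ^ 2 ≤ 1 * y ^ 2 := by gcongr
    have : y * y ≤ y * cn := by gcongr
    nlinarith [mul_pos hy hcn]
  · calc (64 : ℝ) = 4 ^ 3 := by norm_num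
      _ ≤ Real.exp x ^ 3 := by gcongr
      _ = Real.exp (3 * x) := by rw [← Real.exp_nat_mul]; norm_num
      _ ≤ _ := by
        refine Real.exp_le_exp.2 ?_
        have : 3 * x = c0 * y ^ 2 / (y * cn + S) := by rw [hx]; field_simp
        rw [this]
        gcongr

end DPC

set_option maxHeartbeats 1000000 in
/-- Lemma of the paper: concentration of the drift process `L̃^h`. -/
theorem drift_process_concentration
    (w : ∀ n : ℕ, Fin n → ℝ) (μ : Measure ℝ) (hC : CondC w μ)
    (f : ℕ → ℝ) (hf : f =o[atTop] fun n : ℕ => (n : ℝ) ^ ((1 : ℝ) / 3)) :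
    ∃ Abar > (0 : ℝ), ∃ A > (0 : ℝ), ∀ m l h : ℕ → ℕ, ∀ y : ℕ → ℝ,
      Cond3 w Abar (fun n => (m n : ℝ)) (fun n => (l n : ℝ)) (fun n => (h n : ℝ)) y →
      ∀ᶠ n : ℕ in atTop,
        sbMeasure n (w n)
          {ω : Fin n → Fin n | ∃ i j : ℕ, l n ≤ i ∧ i ≤ j ∧ j ≤ m n ∧
            y n ≤ |Ltilde (w n) (pf w f n) ω (h n) j - Ltilde (w n) (pf w f n) ω (h n) i -
                ∫ ω', (Ltilde (w n) (pf w f n) ω' (h n) j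
                  - Ltilde (w n) (pf w f n) ω' (h n) i) ∂sbMeasure n (w n)|}
        ≤ ENNReal.ofReal (A * Real.exp
            (-(y n) ^ 2 / (A * (y n * (n : ℝ) ^ ((1 : ℝ) / 3) + ((m n : ℝ) - (l n : ℝ)))))) := by
  have e1 := DPC.e1_pos hC
  obtain ⟨a1, ha1⟩ : ∃ a, a = ∫ x, x ∂μ := ⟨_, rfl⟩
  obtain ⟨a2, ha2⟩ : ∃ a, a = ∫ x, x ^ 2 ∂μ := ⟨_, rfl⟩
  obtain ⟨a3, ha3⟩ : ∃ a, a = ∫ x, x ^ 3 ∂μ := ⟨_, rfl⟩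
  have T1 := DPC.t1 hC
  have T2 := DPC.t2 hC
  have T3 := DPC.t3 hC
  rw [← ha1] at T1 e1
  rw [← ha2] at T2
  rw [← ha3] at T3
  obtain ⟨C, hCdef⟩ : ∃ C : ℝ, C = 1 + 2 / a1 + a1 + |a2| + |a3| := ⟨_, rfl⟩
  have hinv : 0 < 2 / a1 := by positivity
  have C1 : 1 ≤ C := by
    have := abs_nonneg a2
    have := abs_nonneg a3
    linarith
  have Cp : 0 < C := by linarith
  have Ca1 : 1 / C < a1 := by
    have : 2 / a1 ≤ C := by
      have := abs_nonneg a2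
      have := abs_nonneg a3
      linarith
    rw [div_le_iff₀ e1] at this
    rw [div_lt_iff₀ Cp]
    linarith
  have Ca1' : a1 < C := by
    have := abs_nonneg a2
    have := abs_nonneg a3
    linarith
  have Ca2 : a2 < C := by
    have := le_abs_self a2
    have := abs_nonneg a3
    linarith
  have Ca3 : a3 < C := by
    have := le_abs_self a3
    have := abs_nonneg a2
    linarith
  obtain ⟨ε, hε⟩ : ∃ ε : ℝ, ε = 1 / (160 * C ^ 2) := ⟨_, rfl⟩
  have ε0 : 0 < ε := by rw [hε]; positivity
  have C2 : 1 ≤ C ^ 2 := one_le_pow₀ C1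
  have εC : 160 * C ^ 2 * ε = 1 := by rw [hε]; field_simp
  have ε1 : ε ≤ 1 := by nlinarith
  obtain ⟨c0, hc0⟩ : ∃ c0 : ℝ, c0 = ε ^ 2 / (8 * C ^ 2) := ⟨_, rfl⟩
  have c00 : 0 < c0 := by rw [hc0]; positivity
  have c01 : 8 * C ^ 2 * c0 = ε ^ 2 := by rw [hc0]; field_simp
  have c0le : c0 ≤ 1 := by
    have : ε ^ 2 ≤ 1 := pow_le_one₀ ε0.le ε1
    nlinarith
  refine ⟨3 / c0, by positivity, 8 + 1 / c0, by positivity, ?_⟩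
  intro m l h y H3
  obtain ⟨K1, hK1⟩ := H3.d_bigO.bound
  obtain ⟨K2, hK2⟩ := H3.c2.a_sq_bigO.bound
  obtain ⟨K, hK⟩ : ∃ K : ℝ, K = 1 + |K1| + |K2| * C := ⟨_, rfl⟩
  have hK0 : 0 ≤ |K2| * C := by positivity
  have K1' : 1 ≤ K := by have := abs_nonneg K1; linarith
  have Kp : 0 < K := by linarith
  have D2n : 0 ≤ DPC.D2 C K := by unfold DPC.D2; positivity
  have D5n : 0 ≤ DPC.D5 C K := by unfold DPC.D5; positivity
  have D3n : 0 ≤ DPC.D3 C K := by unfold DPC.D3 DPC.D4 DPC.D2; positivity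
  obtain ⟨Q, hQ⟩ : ∃ Q : ℝ, Q = 1 + 4 * C ^ 3 + 2 * c0 + DPC.D3 C K +
    4 * C * DPC.D5 C K * DPC.D2 C K + 8 * C ^ 3 * DPC.D5 C K := ⟨_, rfl⟩
  have q1 : 0 ≤ 4 * C ^ 3 := by positivity
  have q2 : 0 ≤ 4 * C * DPC.D5 C K * DPC.D2 C K := by positivity
  have q3 : 0 ≤ 8 * C ^ 3 * DPC.D5 C K := by positivity
  have Qp : 0 < Q := by linarith
  obtain ⟨δ, hδ⟩ : ∃ δ : ℝ, δ = ε / Q := ⟨_, rfl⟩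
  have δ0 : 0 < δ := by rw [hδ]; positivity
  have δQ : Q * δ = ε := by rw [hδ]; field_simp
  have key : ∀ x, x ≤ Q → x * δ ≤ ε := fun x hx => by
    rw [← δQ]; gcongr
  obtain ⟨B0, hB0, hui⟩ := DPC.ui hC (half_pos δ0)
  obtain ⟨η, hη⟩ : ∃ η : ℝ, η = min δ (min (1 / B0) (δ / 2 / (B0 * C))) := ⟨_, rfl⟩
  have hη0 : 0 < η := by rw [hη]; positivity
  have hη1 : η ≤ δ := by rw [hη]; exact min_le_left _ _
  have hη2 : η * B0 ≤ 1 := by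
    rw [← le_div_iff₀ hB0, hη]; exact (min_le_right _ _).trans (min_le_left _ _)
  have hη3 : η * (B0 * C) ≤ δ / 2 := by
    rw [← le_div_iff₀ (by positivity), hη]; exact (min_le_right _ _).trans (min_le_right _ _)
  have C3 : 0 < C ^ (-((1 : ℝ) / 3)) := Real.rpow_pos_of_pos Cp _
  filter_upwards [DPC.ev_ge T1 Ca1, DPC.ev_le T1 Ca1', DPC.ev_le T2 Ca2, DPC.ev_le T3 Ca3, hui,
    hK1, hK2, eventually_gt_atTop 0, H3.diff_top.eventually_gt_atTop 0,
    H3.c2.b_top.eventually_gt_atTop 0, H3.sum_lito.bound hη0, hC.max_asymp.bound δ0,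
    hf.bound C3, H3.c2.exp_lt] with n g1 g1' g2 g3 gui gK1 gK2 gn gN gy gM gmax gf gexp
  have hn : (0 : ℝ) < n := by exact_mod_cast gn
  have cnp : (0 : ℝ) < (n : ℝ) ^ ((1 : ℝ) / 3) := Real.rpow_pos_of_pos hn _
  have glm : l n < m n := by
    have : (l n : ℝ) < m n := by linarith
    exact_mod_cast this
  have ℓlo : (n : ℝ) ≤ C * ∑ k, w n k := by
    rw [one_div, inv_mul_le_iff₀ Cp] at g1
    exact g1
  have hell : 0 < ell w n := by
    unfold ell
    by_contra hcon
    push Not at hcon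
    nlinarith
  have hm0 : (0 : ℝ) ≤ m n := Nat.cast_nonneg _
  have hl0 : (0 : ℝ) ≤ l n := Nat.cast_nonneg _
  have hh0 : (0 : ℝ) ≤ h n := Nat.cast_nonneg _
  have Meq : ((m n + h n : ℕ) : ℝ) = (m n : ℝ) + h n := by push_cast; ring
  have Mpos : (0 : ℝ) < (m n : ℝ) + h n := by linarith
  rw [Real.norm_of_nonneg Mpos.le, Real.norm_of_nonneg hn.le] at gM
  have NMn : 0 ≤ ((m n : ℝ) - l n) * ((m n : ℝ) + h n) := by positivity
  have hS : (m n : ℝ) - l n ≤ Real.sqrt (((m n : ℝ) - l n) * ((m n : ℝ) + h n)) := by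
    apply Real.le_sqrt_of_sq_le
    rw [sq]
    gcongr
    linarith
  obtain ⟨hcny, hΛ⟩ := DPC.lam_aux c00 c0le gy cnp gN hS gexp
  have hfb : |f n| ≤ ell w n ^ ((1 : ℝ) / 3) := by
    rw [Real.norm_eq_abs, Real.norm_of_nonneg cnp.le] at gf
    refine gf.trans ?_
    have : (n : ℝ) ^ ((1 : ℝ) / 3) ≤ C ^ ((1 : ℝ) / 3) * ell w n ^ ((1 : ℝ) / 3) := by
      rw [← Real.mul_rpow Cp.le hell.le]
      exact Real.rpow_le_rpow hn.le ℓlo (by norm_num)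
    calc _ ≤ C ^ (-((1 : ℝ) / 3)) * (C ^ ((1 : ℝ) / 3) * ell w n ^ ((1 : ℝ) / 3)) := by gcongr
      _ = _ := by
        rw [← mul_assoc, ← Real.rpow_add Cp]
        simp
  obtain ⟨p0, pl⟩ := DPC.pf_bd hell hfb
  have HF : DPC.FH C K δ ε c0 (y n) ((n : ℝ) ^ ((1 : ℝ) / 3)) (pf w f n) (w n)
      (l n) (m n) (h n) :=
    { n0 := gn
      hw := hC.w_pos n
      C1 := C1
      K1 := K1'
      δ0 := δ0.le
      δ1 := by have := key 1 (by linarith); linarith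
      δs := (key _ (by linarith)).trans ε1
      ε0 := ε0
      ε1 := ε1
      εC := εC.le
      c00 := c00
      c01 := c01.le
      c02 := key _ (by linarith)
      δ3 := key _ (by linarith)
      δ4 := key _ (by linarith)
      δ5 := key _ (by linarith)
      y0 := gy
      lm := glm
      cn0 := cnp
      cny := hcny
      ℓlo := ℓlo
      s2 := g2
      s3 := g3
      yN := by
        rw [Real.norm_of_nonneg gy.le, Real.norm_of_nonneg gN.le] at gK1
        refine gK1.trans ?_
        have := le_abs_self K1
        gcongr
        linarith
      NM := by
        rw [Meq]
        have hye := mul_pos gy hell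
        rw [Real.norm_of_nonneg (by positivity), Real.norm_of_nonneg hye.le,
          Real.sq_sqrt NMn] at gK2
        refine gK2.trans ?_
        calc K2 * (y n * ell w n) ≤ |K2| * (y n * (C * n)) := by
              gcongr
              · exact le_abs_self _
              · exact g1'
          _ = |K2| * C * y n * n := by ring
          _ ≤ K * y n * n := by
              have := abs_nonneg K1
              gcongr
              linarith
      Mn := by rw [Meq]; exact gM.trans (by gcongr)
      h2 := by
        rw [Meq]
        refine DPC.heavy (hC.w_pos n) Mpos hn ?_ (gui.trans ?_)
        · calc _ ≤ η * n * B0 := by gcongr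
            _ = η * B0 * n := by ring
            _ ≤ 1 * n := by gcongr
            _ = n := one_mul _
        · gcongr; linarith
      h4 := by
        rw [Meq]
        refine DPC.light (hC.w_pos n) Mpos hn hB0 ?_ g3 gui
        calc _ ≤ η * n * (B0 * C) := by gcongr
            _ = η * (B0 * C) * n := by ring
            _ ≤ _ := by gcongr
      wmax := fun i => by
        rw [Real.norm_of_nonneg cnp.le] at gmax
        exact (le_ciSup (Set.finite_range (w n)).bddAbove i).trans ((le_abs_self _).trans gmax)
      p0 := p0
      pl := pl
      Λ64 := hΛ }
  refine HF.main.trans (ENNReal.ofReal_le_ofReal ?_)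
  have hA : 0 < 1 / c0 := by positivity
  have hD : 0 < y n * (n : ℝ) ^ ((1 : ℝ) / 3) + ((m n : ℝ) - (l n : ℝ)) := by positivity
  have hex : -DPC.Lam c0 (y n) ((n : ℝ) ^ ((1 : ℝ) / 3)) (l n) (m n) ≤ -(y n) ^ 2 /
      ((8 + 1 / c0) * (y n * (n : ℝ) ^ ((1 : ℝ) / 3) + ((m n : ℝ) - (l n : ℝ)))) := by
    unfold DPC.Lam
    rw [neg_div]
    refine neg_le_neg ?_
    have : c0 * y n ^ 2 / (y n * (n : ℝ) ^ ((1 : ℝ) / 3) + ((m n : ℝ) - (l n : ℝ))) =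
      y n ^ 2 / (1 / c0 * (y n * (n : ℝ) ^ ((1 : ℝ) / 3) + ((m n : ℝ) - (l n : ℝ)))) := by
      field_simp
    rw [this]
    gcongr
    linarith
  have := Real.exp_le_exp.2 hex
  calc _ ≤ 8 * Real.exp (-(y n) ^ 2 /
      ((8 + 1 / c0) * (y n * (n : ℝ) ^ ((1 : ℝ) / 3) + ((m n : ℝ) - (l n : ℝ))))) := by gcongr
    _ ≤ _ := by
      gcongr
      linarith
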